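/- Let R be a Gorenstein local ring of dimension d and let M be a finitely generated R-module. Then β̂_i^R(M) = μ̂^{d−i−1}_R(M) for all i ∈ ℤ, i.e., the i-th stable Betti number of M equals the (d−i−1)-th stable Bass number of M. -/

import Mathlib

open CategoryTheory CategoryTheory.Limits CategoryTheory.MonoidalCategory Opposite

noncomputable section

universe u

variable (R : Type u) [CommRing R]

/-- Ordinary `Ext` of `R`-modules, via the derived functor `Ext` of Mathlib. -/
abbrev ExtMod (n : ℕ) (M N : ModuleCat.{u} R) : ModuleCat.{u} R :=
  ((Ext R (ModuleCat.{u} R) n).obj (op M)).obj N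

/-- Ordinary `Tor` of `R`-modules, via the derived functor `Tor` of Mathlib. -/
abbrev TorMod (n : ℕ) (M N : ModuleCat.{u} R) : ModuleCat.{u} R :=
  ((Tor (ModuleCat.{u} R) n).obj M).obj N

/-- A finitely generated module `M` is totally reflexive (of G-dimension zero) if the
biduality map is an isomorphism and `Ext^i(M,R) = 0 = Ext^i(M^*,R)` for all `i > 0`. -/
def IsTotallyReflexive (M : ModuleCat.{u} R) : Prop :=
  Module.Finite R M ∧
  Function.Bijective (Module.Dual.eval R M) ∧
  (∀ i : ℕ, 0 < i → IsZero (ExtMod R i M (ModuleCat.of R R))) ∧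
  (∀ i : ℕ, 0 < i → IsZero (ExtMod R i (ModuleCat.of R (Module.Dual R M)) (ModuleCat.of R R)))

/-- `M` admits a resolution `0 → G_n → ⋯ → G_0 → M → 0` by totally reflexive modules. -/
def GDimLE (M : ModuleCat.{u} R) (n : ℕ) : Prop :=
  ∃ (G : ChainComplex (ModuleCat.{u} R) ℕ) (ε : G.X 0 ⟶ M),
    (∀ i, i ≤ n → IsTotallyReflexive R (G.X i)) ∧
    (∀ i, n < i → IsZero (G.X i)) ∧
    Epi ε ∧
    (∃ w : G.d 1 0 ≫ ε = 0, (ShortComplex.mk (G.d 1 0) ε w).Exact) ∧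
    (∀ i, 0 < i → G.ExactAt i)

/-- `M` has finite Gorenstein dimension. -/
def HasFiniteGDim (M : ModuleCat.{u} R) : Prop := ∃ n, GDimLE R M n

/-- The Gorenstein dimension of `M`, as an element of `ℕ∞`. -/
def gdim (M : ModuleCat.{u} R) : ℕ∞ :=
  sInf {c : ℕ∞ | ∃ n : ℕ, c = n ∧ GDimLE R M n}

/-- `M` admits a projective resolution of length at most `n`. -/
def PdLE (M : ModuleCat.{u} R) (n : ℕ) : Prop :=
  ∃ (G : ChainComplex (ModuleCat.{u} R) ℕ) (ε : G.X 0 ⟶ M),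
    (∀ i, Projective (G.X i)) ∧
    (∀ i, n < i → IsZero (G.X i)) ∧
    Epi ε ∧
    (∃ w : G.d 1 0 ≫ ε = 0, (ShortComplex.mk (G.d 1 0) ε w).Exact) ∧
    (∀ i, 0 < i → G.ExactAt i)

/-- `M` has finite projective dimension. -/
def HasFinitePd (M : ModuleCat.{u} R) : Prop := ∃ n, PdLE R M n

/-- The projective dimension of `M`, as an element of `ℕ∞`. -/
def pdim (M : ModuleCat.{u} R) : ℕ∞ :=
  sInf {c : ℕ∞ | ∃ n : ℕ, c = n ∧ PdLE R M n}

/-- `M` admits an injective resolution `0 → M → I^0 → ⋯ → I^n → 0`. -/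
def InjDimLE (M : ModuleCat.{u} R) (n : ℕ) : Prop :=
  ∃ (I : CochainComplex (ModuleCat.{u} R) ℕ) (ι : M ⟶ I.X 0),
    (∀ i, Injective (I.X i)) ∧
    (∀ i, n < i → IsZero (I.X i)) ∧
    Mono ι ∧
    (∃ w : ι ≫ I.d 0 1 = 0, (ShortComplex.mk ι (I.d 0 1) w).Exact) ∧
    (∀ i, 0 < i → I.ExactAt i)

/-- `M` has finite injective dimension. -/
def HasFiniteInjDim (M : ModuleCat.{u} R) : Prop := ∃ n, InjDimLE R M n

/-- A Gorenstein local ring: a commutative Noetherian local ring of finite self-injective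
dimension. -/
def IsGorensteinLocalRing : Prop :=
  IsLocalRing R ∧ IsNoetherianRing R ∧ HasFiniteInjDim R (ModuleCat.of R R)

/-- The grade of a module: `grade M = inf { i | Ext^i(M,R) ≠ 0 }`. -/
def gradeM (M : ModuleCat.{u} R) : ℕ∞ :=
  sInf {c : ℕ∞ | ∃ i : ℕ, c = i ∧ ¬ IsZero (ExtMod R i M (ModuleCat.of R R))}

/-- A module is G-perfect if its grade equals its Gorenstein dimension. -/
def IsGPerfect (M : ModuleCat.{u} R) : Prop := gradeM R M = gdim R M

/-- An ideal `c` is perfect if `grade (R/c) = pd (R/c)`. -/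
def IsPerfectIdeal (c : Ideal R) : Prop :=
  gradeM R (ModuleCat.of R (R ⧸ c)) = pdim R (ModuleCat.of R (R ⧸ c))

/-- A complete resolution `T → P → M` of `M`: `P → M` is a resolution by finite projective
modules, `T` is a totally acyclic complex of finite projective modules, and `θ i` is an
isomorphism for all `i ≫ 0`. -/
structure CompleteResolution (M : ModuleCat.{u} R) where
  T : ChainComplex (ModuleCat.{u} R) ℤ
  P : ChainComplex (ModuleCat.{u} R) ℤ
  θ : T ⟶ P
  π : P.X 0 ⟶ M
  projT : ∀ i, Projective (T.X i)
  fgT : ∀ i, Module.Finite R (T.X i)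
  projP : ∀ i, Projective (P.X i)
  fgP : ∀ i, Module.Finite R (P.X i)
  zeroP : ∀ i : ℤ, i < 0 → IsZero (P.X i)
  epiπ : Epi π
  wπ : P.d 1 0 ≫ π = 0
  exact0 : (ShortComplex.mk (P.d 1 0) π wπ).Exact
  exactP : ∀ i : ℤ, 0 < i → P.ExactAt i
  exactT : ∀ i : ℤ, T.ExactAt i
  exactTdual : ∀ i : ℤ, (T.linearYonedaObj R (ModuleCat.of R R)).ExactAt i
  iso_eventually : ∃ n₀ : ℤ, ∀ i : ℤ, n₀ ≤ i → IsIso (θ.f i)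

/-- Tate cohomology `Êxt^i(M,N) = H^i(Hom(T,N))` computed from a complete resolution of `M`. -/
def TateExt {M : ModuleCat.{u} R} (C : CompleteResolution R M) (N : ModuleCat.{u} R)
    (i : ℤ) : ModuleCat.{u} R :=
  (C.T.linearYonedaObj R N).homology i

/-- Tate homology `T̂or_i(M,N) = H_i(T ⊗ N)` computed from a complete resolution of `M`. -/
def TateTor {M : ModuleCat.{u} R} (C : CompleteResolution R M) (N : ModuleCat.{u} R)
    (i : ℤ) : ModuleCat.{u} R :=
  ((((tensoringRight (ModuleCat.{u} R)).obj N).mapHomologicalComplex _).obj C.T).homology i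

/-- The depth of a module over a local ring: the supremum of the lengths of the
`M`-regular sequences contained in the maximal ideal. -/
def moduleDepth [IsLocalRing R] (M : Type u) [AddCommGroup M] [Module R M] : ℕ∞ :=
  sSup {c : ℕ∞ | ∃ rs : List R, c = rs.length ∧
    (∀ r ∈ rs, r ∈ IsLocalRing.maximalIdeal R) ∧ RingTheory.Sequence.IsRegular M rs}

/-- `E` is an injective envelope of the residue field `k`: an injective module which is an
essential extension of `k`. -/
def IsInjectiveEnvelopeOfResidueField [IsLocalRing R] (E : Type u) [AddCommGroup E]
    [Module R E] : Prop :=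
  Injective (ModuleCat.of R E) ∧
  ∃ ι : IsLocalRing.ResidueField R →ₗ[R] E,
    Function.Injective ι ∧
    ∀ N : Submodule R E, N ≠ ⊥ → N ⊓ LinearMap.range ι ≠ ⊥


/-- A minimal free resolution `⋯ → F_1 → F_0 → M → 0` of a finitely generated module over a
local ring, recorded by its Betti numbers `b n` and differentials with image inside
`m • F_n`. -/
structure MinFreeRes [IsLocalRing R] (M : Type u) [AddCommGroup M] [Module R M] where
  b : ℕ → ℕ
  d : ∀ n : ℕ, ((Fin (b (n+1)) → R) →ₗ[R] (Fin (b n) → R))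
  aug : (Fin (b 0) → R) →ₗ[R] M
  aug_surj : Function.Surjective aug
  exact_zero : LinearMap.ker aug = LinearMap.range (d 0)
  exact_succ : ∀ n, LinearMap.ker (d n) = LinearMap.range (d (n+1))
  minimal : ∀ n, LinearMap.range (d n) ≤ (IsLocalRing.maximalIdeal R) • ⊤

/-- The Betti numbers of `M` are eventually bounded by `γ · n^(c-1)`. -/
def CxLE [IsLocalRing R] (M : Type u) [AddCommGroup M] [Module R M] (c : ℕ) : Prop :=
  ∃ (F : MinFreeRes R M) (γ : ℝ) (n₀ : ℕ),
    ∀ n : ℕ, n₀ ≤ n → (F.b n : ℝ) ≤ γ * (n : ℝ) ^ ((c : ℤ) - 1)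

/-- The complexity of a module: the least `c` such that the Betti numbers are eventually
bounded by `γ · n^(c-1)` for some `γ`. -/
def complexity [IsLocalRing R] (M : Type u) [AddCommGroup M] [Module R M] : ℕ∞ :=
  sInf {e : ℕ∞ | ∃ c : ℕ, e = c ∧ CxLE R M c}

/-- The pushout `K_η` of a map `f : Ω^{j+1} M → M` (representing a degree-`(j+1)`
homogeneous element `η` of `Ext^*(M,M)`) along the inclusion `Ω^{j+1} M ↪ F_j`: the
cokernel of `(f, -incl) : Ω^{j+1} M → M ⊕ F_j`. -/
abbrev PushoutMod [IsLocalRing R] {M : Type u} [AddCommGroup M] [Module R M]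
    (F : MinFreeRes R M) (j : ℕ) (f : LinearMap.range (F.d j) →ₗ[R] M) : Type u :=
  (M × (Fin (F.b j) → R)) ⧸
    LinearMap.range (LinearMap.prod f (-(LinearMap.range (F.d j)).subtype))

/-- Auxiliary predicate: `M` has reducible complexity, with recursion depth `≤ c`. -/
def RedCxAux [IsLocalRing R] :
    ℕ → ∀ (M : Type u) (_ : AddCommGroup M) (_ : Module R M), Prop
  | 0, M, g, m =>
      letI := g; letI := m
      HasFinitePd R (ModuleCat.of R M)
  | (c+1), M, g, m =>
      letI := g; letI := m
      HasFinitePd R (ModuleCat.of R M) ∨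
      (complexity R M < ⊤ ∧ 0 < complexity R M ∧
        ∃ (j : ℕ) (F : MinFreeRes R M) (f : LinearMap.range (F.d j) →ₗ[R] M),
          complexity R (PushoutMod R F j f) < complexity R M ∧
          moduleDepth R (PushoutMod R F j f) = moduleDepth R M ∧
          RedCxAux c (PushoutMod R F j f) inferInstance inferInstance)

/-- `M` has reducible complexity. -/
def HasReducibleComplexity [IsLocalRing R] (M : Type u) [AddCommGroup M] [Module R M] :
    Prop :=
  ∃ c : ℕ, RedCxAux R c M inferInstance inferInstance

/-- `L` is (isomorphic to) `λ N = Ω Tr N`, computed from a minimal free presentation of `N`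
over the local ring `S`. -/
def IsLambdaOf (S : Type u) [CommRing S] [IsLocalRing S]
    (N L : Type u) [AddCommGroup N] [Module S N] [AddCommGroup L] [Module S L] : Prop :=
  ∃ (n₀ n₁ : ℕ) (g : (Fin n₀ → S) →ₗ[S] N) (f : (Fin n₁ → S) →ₗ[S] (Fin n₀ → S)),
    Function.Surjective g ∧
    LinearMap.range f = LinearMap.ker g ∧
    LinearMap.ker g ≤ (IsLocalRing.maximalIdeal S) • ⊤ ∧
    LinearMap.ker f ≤ (IsLocalRing.maximalIdeal S) • ⊤ ∧
    Nonempty (L ≃ₗ[S] LinearMap.range f.dualMap)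

/-- `M` and `N` are linked by the ideal `c`: both are annihilated by `c` (hence are
`R/c`-modules) and `M ≅ λ_{R/c} N`, `N ≅ λ_{R/c} M`. -/
def LinkedBy (c : Ideal R) (M N : Type u) [AddCommGroup M] [Module (R ⧸ c) M]
    [AddCommGroup N] [Module (R ⧸ c) N] [IsLocalRing (R ⧸ c)] : Prop :=
  IsLambdaOf (R ⧸ c) N M ∧ IsLambdaOf (R ⧸ c) M N


namespace Stmt6

/-- multiplication by an element killing the first argument is zero on `Ext`. -/
lemma ext_smul_eq_zero_left {R : Type} [CommRing R] {N M : ModuleCat.{0} R} {x : R}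
    (hx : ∀ y : N, x • y = 0) {n : ℕ} (a : Abelian.Ext N M n) : x • a = 0 := by
  have : x • 𝟙 N = 0 := by
    ext y
    exact hx y
  have smul_eq : x • a = (Abelian.Ext.mk₀ (x • 𝟙 N)).comp a (zero_add n) := by
    simp [Abelian.Ext.mk₀_smul]
  rw [smul_eq, this]
  simp

lemma ext_comp_smul_id {R : Type} [CommRing R] {N M : ModuleCat.{0} R} (x : R)
    {n : ℕ} (a : Abelian.Ext N M n) :
    a.comp (Abelian.Ext.mk₀ (x • 𝟙 M)) (add_zero n) = x • a := by
  simp [Abelian.Ext.mk₀_smul]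

lemma exists_delta {R : Type} [CommRing R] (M : ModuleCat.{0} R) (x : R) (hx : IsSMulRegular M x) :
    ∃ δ : Abelian.Ext (ModuleCat.of R (QuotSMulTop x M)) M 1,
      (∀ (N : ModuleCat.{0} R) (n : ℕ) (a : Abelian.Ext N M (n + 1)), x • a = 0 →
        ∃ b : Abelian.Ext N (ModuleCat.of R (QuotSMulTop x M)) n, b.comp δ rfl = a) ∧
      (∀ (N : ModuleCat.{0} R) (n : ℕ)
        (b : Abelian.Ext N (ModuleCat.of R (QuotSMulTop x M)) n), b.comp δ rfl = 0 →
        (∀ c : Abelian.Ext N M n, c = 0) → b = 0) ∧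
      (∀ (Y : ModuleCat.{0} R) (n : ℕ)
        (b : Abelian.Ext (ModuleCat.of R (QuotSMulTop x M)) Y (1 + n)),
        (∀ c : Abelian.Ext M Y (1 + n), c = 0) → (∀ c : Abelian.Ext M Y n, c = 0) → b = 0) := by
  have hS := hx.smulShortComplex_shortExact
  refine ⟨hS.extClass, ?_, ?_, ?_⟩
  · intro N n a ha
    refine Abelian.Ext.covariant_sequence_exact₁ N hS a ?_ rfl
    rw [ModuleCat.smulShortComplex_f_eq_smul_id]
    exact (ext_comp_smul_id x a).trans ha
  · intro N n b hb hc
    obtain ⟨c, h⟩ := Abelian.Ext.covariant_sequence_exact₃ N hS b rfl hb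
    have h0 : c = 0 := hc c
    subst h0
    exact h.symm.trans (Abelian.Ext.zero_comp ..)
  · intro Y n b h1 h2
    obtain ⟨c, h⟩ := Abelian.Ext.contravariant_sequence_exact₃ hS Y b (h1 _) rfl
    have h0 : c = 0 := h2 c
    subst h0
    exact h.symm.trans (Abelian.Ext.comp_zero ..)

/-- The Koszul-type class of a weakly regular sequence. -/
lemma exists_koszul_class {R : Type} [CommRing R] (xs : List R) :
    ∀ (M : ModuleCat.{0} R), RingTheory.Sequence.IsWeaklyRegular M xs →
    ∃ (Q : ModuleCat.{0} R) (_ : Nonempty (Q ≃ₗ[R] (M ⧸ (Ideal.ofList xs • ⊤ : Submodule R M))))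
      (e : Abelian.Ext Q M xs.length),
      (∀ N : ModuleCat.{0} R, (∀ x ∈ xs, ∀ y : N, x • y = 0) →
        (∀ i < xs.length, ∀ a : Abelian.Ext N M i, a = 0) ∧
        Function.Bijective
          (fun φ : Abelian.Ext N Q 0 => φ.comp e (zero_add xs.length))) ∧
      (∀ (Y : ModuleCat.{0} R) (s : ℕ), (∀ i, s < i → ∀ a : Abelian.Ext M Y i, a = 0) →
        ∀ i, s + xs.length < i → ∀ a : Abelian.Ext Q Y i, a = 0) := by
  induction xs with
  | nil =>
    intro M _
    refine ⟨M, ⟨(Submodule.quotEquivOfEqBot _ (by simp)).symm⟩, Abelian.Ext.mk₀ (𝟙 M), ?_, ?_⟩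
    · intro N _
      refine ⟨fun i hi => by simp at hi, ?_⟩
      have : (fun φ : Abelian.Ext N M 0 =>
          φ.comp (Abelian.Ext.mk₀ (𝟙 M)) (zero_add 0)) = id := by
        funext φ
        simp
      exact this ▸ Function.bijective_id
    · intro Y s h i hi
      exact h i (by simpa using hi)
  | cons x xs ih =>
    intro M hM
    rw [RingTheory.Sequence.isWeaklyRegular_cons_iff] at hM
    obtain ⟨hx, hxs⟩ := hM
    obtain ⟨δ, hδ1, hδ2, hδ3⟩ := exists_delta M x hx
    obtain ⟨Q, ⟨eQ⟩, e, h1, h2⟩ := ih (ModuleCat.of R (QuotSMulTop x M)) hxs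
    refine ⟨Q, ⟨eQ.trans (Submodule.quotOfListConsSMulTopEquivQuotSMulTopInner M x xs).symm⟩,
      e.comp δ rfl, ?_, ?_⟩
    · intro N hN
      obtain ⟨h3, h4⟩ := h1 N (fun y hy => hN y (List.mem_cons_of_mem _ hy))
      have hxN := hN x List.mem_cons_self
      have h5 : ∀ i < (x :: xs).length, ∀ a : Abelian.Ext N M i, a = 0 := by
        intro i hi a
        have h0 : x • a = 0 := ext_smul_eq_zero_left hxN a
        rcases i with _ | i
        · obtain ⟨f, rfl⟩ := (Abelian.Ext.homEquiv₀ (X := N) (Y := M)).symm.surjective a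
          have hf : f = 0 := by
            ext y
            apply hx
            change x • f.hom y = x • 0
            rw [smul_zero, ← map_smul, hxN, map_zero]
          simp [hf]
        · obtain ⟨b, hb⟩ := hδ1 N i a h0
          have : b = 0 := h3 i (by simpa using hi) b
          rw [← hb, this]
          simp
      refine ⟨h5, ?_⟩
      have hfun : (fun φ : Abelian.Ext N Q 0 =>
          φ.comp (e.comp δ rfl) (zero_add (x :: xs).length)) =
          (fun b : Abelian.Ext N (ModuleCat.of R (QuotSMulTop x M)) xs.length =>
            b.comp δ rfl) ∘
          (fun φ : Abelian.Ext N Q 0 => φ.comp e (zero_add xs.length)) := by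
        funext φ
        simp only [Function.comp]
        rw [Abelian.Ext.comp_assoc]
        simp
      rw [hfun]
      refine Function.Bijective.comp ⟨?_, ?_⟩ h4
      · intro b b' hbb
        have : (b - b').comp δ (rfl : xs.length + 1 = _) = 0 := by
          have hbb' : b.comp δ (rfl : xs.length + 1 = _) =
            b'.comp δ rfl := hbb
          rw [sub_eq_add_neg, Abelian.Ext.add_comp, Abelian.Ext.neg_comp, hbb']
          simp
        rw [← sub_eq_zero]
        exact hδ2 N _ _ this (h5 _ (by simp))
      · intro a
        have h0 : x • a = 0 := ext_smul_eq_zero_left hxN a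
        exact hδ1 N _ a h0
    · intro Y s h i hi a
      refine h2 Y (s + 1) ?_ i (by simp at hi ⊢; omega) a
      intro j hj b
      obtain ⟨j, rfl⟩ : ∃ j', j = 1 + j' := ⟨j - 1, by omega⟩
      exact hδ3 Y _ b (h _ (by omega)) (h _ (by omega))

/-- short exact sequences from linear maps -/
lemma shortExact_mk {R : Type} [CommRing R] {A B C : ModuleCat.{0} R} (f : A ⟶ B) (g : B ⟶ C)
    (hf : Function.Injective f.hom) (hg : Function.Surjective g.hom)
    (h : Function.Exact f.hom g.hom) :
    ∃ w : f ≫ g = 0, (ShortComplex.mk f g w).ShortExact := by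
  refine ⟨?_, ?_⟩
  · ext x
    exact h.apply_apply_eq_zero x
  · have : Mono f := (ModuleCat.mono_iff_injective f).2 hf
    have : Epi g := (ModuleCat.epi_iff_surjective g).2 hg
    exact { exact := (ShortComplex.ShortExact.moduleCat_exact_iff_function_exact _).2 h
            mono_f := ‹_›
            epi_g := ‹_› }

lemma exactAt_function {R : Type} [CommRing R] {ι : Type} {c : ComplexShape ι}
    (K : HomologicalComplex (ModuleCat.{0} R) c) (i j k : ι) (hi : c.prev j = i)
    (hk : c.next j = k) (h : K.ExactAt j) :
    Function.Exact (K.d i j).hom (K.d j k).hom :=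
  (ShortComplex.ShortExact.moduleCat_exact_iff_function_exact _).1
    ((K.exactAt_iff' i j k hi hk).1 h)

/-- finite injective dimension in the sense of Mathlib -/
lemma hasInjectiveDimensionLT_of_injDimLE {R : Type} [CommRing R] (n : ℕ)
    (M : ModuleCat.{0} R) (hM : InjDimLE R M n) : HasInjectiveDimensionLT M (n + 1) := by
  obtain ⟨I, ι, hI, h0, hι, ⟨w, hw⟩, hex⟩ := hM
  have key : ∀ m j, m + j = n + 1 →
      HasInjectiveDimensionLT (ModuleCat.of R (LinearMap.ker (I.d j (j + 1)).hom)) m := by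
    intro m
    induction m with
    | zero =>
      intro j hj
      apply IsZero.hasInjectiveDimensionLT_zero
      have hz := h0 j (by omega)
      have := ModuleCat.subsingleton_of_isZero hz
      exact ModuleCat.isZero_of_subsingleton _
    | succ m ih =>
      intro j hj
      have h3 := ih (j + 1) (by omega)
      have hE := exactAt_function I j (j + 1) (j + 1 + 1) (by simp) (by simp) (hex (j + 1) (by omega))
      have hE' : ∀ x, (I.d (j+1) (j + 1 + 1)).hom ((I.d j (j + 1)).hom x) = 0 :=
        fun x => hE.apply_apply_eq_zero x
      obtain ⟨w', hS⟩ := shortExact_mk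
        (ModuleCat.ofHom (LinearMap.ker (I.d j (j + 1)).hom).subtype)
        (ModuleCat.ofHom (LinearMap.codRestrict (LinearMap.ker (I.d (j+1) (j + 1 + 1)).hom)
          (I.d j (j + 1)).hom hE')) Subtype.val_injective
        (by
          rintro ⟨y, hy⟩
          obtain ⟨x, hx⟩ := (hE y).1 hy
          exact ⟨x, Subtype.ext hx⟩)
        (by
          intro x
          constructor
          · intro hx
            exact ⟨⟨x, congrArg Subtype.val hx⟩, rfl⟩
          · rintro ⟨y, rfl⟩
            exact Subtype.ext y.2)
      have := hI j
      exact hS.hasInjectiveDimensionLT_X₁ (m) h3 (inferInstanceAs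
        (HasInjectiveDimensionLT (I.X j) (m + 1)))
  have h1 := key (n + 1) 0 (by omega)
  have hinj := (ModuleCat.mono_iff_injective ι).1 hι
  have hfe := (ShortComplex.ShortExact.moduleCat_exact_iff_function_exact _).1 hw
  let e : M ≃ₗ[R] LinearMap.ker (I.d 0 1).hom := LinearEquiv.ofBijective
    (LinearMap.codRestrict _ ι.hom (fun x => hfe.apply_apply_eq_zero x))
    ⟨fun a b h => hinj (congrArg Subtype.val h), by
      rintro ⟨y, hy⟩
      obtain ⟨x, hx⟩ := (hfe y).1 hy
      exact ⟨x, Subtype.ext hx⟩⟩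
  exact hasInjectiveDimensionLT_of_iso e.symm.toModuleIso _

end Stmt6


namespace Stmt6

/-- lifting along a mono when the next `Ext` of the cokernel vanishes -/
lemma ext_lift_contra {R : Type} [CommRing R] {A B C : ModuleCat.{0} R} (f : A ⟶ B) (g : B ⟶ C)
    (hf : Function.Injective f.hom) (hg : Function.Surjective g.hom)
    (h : Function.Exact f.hom g.hom) (Y : ModuleCat.{0} R) (i : ℕ)
    (hC : ∀ c : Abelian.Ext C Y (i + 1), c = 0) (a : Abelian.Ext A Y i) :
    ∃ b : Abelian.Ext B Y i, (Abelian.Ext.mk₀ f).comp b (zero_add i) = a := by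
  obtain ⟨w, hS⟩ := shortExact_mk f g hf hg h
  exact Abelian.Ext.contravariant_sequence_exact₁ hS Y a (add_comm 1 i) (hC _)

lemma ext_left_zero {R : Type} [CommRing R] {A B C : ModuleCat.{0} R} (f : A ⟶ B) (g : B ⟶ C)
    (hf : Function.Injective f.hom) (hg : Function.Surjective g.hom)
    (h : Function.Exact f.hom g.hom) (Y : ModuleCat.{0} R) (i : ℕ)
    (hC : ∀ c : Abelian.Ext C Y (i + 1), c = 0) (hB : ∀ c : Abelian.Ext B Y i, c = 0)
    (a : Abelian.Ext A Y i) : a = 0 := by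
  obtain ⟨b, rfl⟩ := ext_lift_contra f g hf hg h Y i hC a
  rw [hB b, Abelian.Ext.comp_zero]

lemma ext_mid_zero {R : Type} [CommRing R] {A B C : ModuleCat.{0} R} (f : A ⟶ B) (g : B ⟶ C)
    (hf : Function.Injective f.hom) (hg : Function.Surjective g.hom)
    (h : Function.Exact f.hom g.hom) (Y : ModuleCat.{0} R) (i : ℕ)
    (hC : ∀ c : Abelian.Ext C Y i, c = 0) (hA : ∀ c : Abelian.Ext A Y i, c = 0)
    (a : Abelian.Ext B Y i) : a = 0 := by
  obtain ⟨w, hS⟩ := shortExact_mk f g hf hg h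
  obtain ⟨c, hc⟩ := Abelian.Ext.contravariant_sequence_exact₂ hS Y a (hA _)
  have h0 : c = 0 := hC c
  subst h0
  exact hc.symm.trans (Abelian.Ext.comp_zero ..)

/-- descending induction: vanishing of high `Ext`. -/
lemma ext_vanish_above {R : Type} [CommRing R] [IsLocalRing R] [IsNoetherianRing R]
    (n : ℕ) (hn : HasInjectiveDimensionLT (ModuleCat.of R R) n) (t : ℕ) (S : ModuleCat.{0} R)
    [Module.Finite R S] (ι : ModuleCat.of R (IsLocalRing.ResidueField R) ⟶ S)
    (hι : Function.Injective ι.hom)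
    (hS : ∀ i, t < i → ∀ a : Abelian.Ext S (ModuleCat.of R R) i, a = 0) :
    ∀ i, t < i → ∀ (N : Type) [AddCommGroup N] [Module R N] [Module.Finite R N]
      (a : Abelian.Ext (ModuleCat.of R N) (ModuleCat.of R R) i), a = 0 := by
  have key : ∀ m i, i + m = n + t → t < i → ∀ (N : Type) [AddCommGroup N] [Module R N]
      [Module.Finite R N]
      (a : Abelian.Ext (ModuleCat.of R N) (ModuleCat.of R R) i), a = 0 := by
    intro m
    induction m with
    | zero =>
      intro i hi _ N _ _ _ a
      exact a.eq_zero_of_hasInjectiveDimensionLT n (by omega)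
    | succ m ih =>
      intro i hi hti N _ _ hNf
      have ih' := ih (i + 1) (by omega) (by omega)
      refine IsNoetherianRing.induction_on_isQuotientEquivQuotientPrime R (M := N) hNf
        (motive := fun N _ _ _ => ∀ (a : Abelian.Ext (ModuleCat.of R N) (ModuleCat.of R R) i), a = 0)
        ?_ ?_ ?_
      · intro N _ _ _ _ a
        have : 𝟙 (ModuleCat.of R N) = 0 := by
          ext y
          exact Subsingleton.elim _ _
        rw [← Abelian.Ext.mk₀_id_comp a, this]
        simp
      · intro N _ _ _ p e
        by_cases hp : p.1 = IsLocalRing.maximalIdeal R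
        · let e' : N ≃ₗ[R] IsLocalRing.ResidueField R :=
            e.trans (Submodule.quotEquivOfEq _ _ hp)
          let f : N →ₗ[R] S := ι.hom ∘ₗ e'.toLinearMap
          have hf : Function.Injective f := hι.comp e'.injective
          exact ext_left_zero (ModuleCat.ofHom f)
            (ModuleCat.ofHom (LinearMap.range f).mkQ) hf (Submodule.mkQ_surjective _)
            (LinearMap.exact_map_mkQ_range f) _ i (ih' _) (hS i hti)
        · have hlt : p.1 < IsLocalRing.maximalIdeal R :=
            lt_of_le_of_ne (IsLocalRing.le_maximalIdeal p.2.ne_top) hp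
          obtain ⟨x, hxm, hxp⟩ := SetLike.exists_of_lt hlt
          let f : N →ₗ[R] N := x • LinearMap.id
          have hf : Function.Injective f := by
            rw [injective_iff_map_eq_zero]
            intro y hy
            have hy' : x • e y = 0 := by
              rw [← map_smul]
              exact (congrArg e hy).trans (map_zero e)
            apply e.injective
            rw [map_zero]
            obtain ⟨z, hz⟩ := Ideal.Quotient.mk_surjective (e y)
            rw [← hz] at hy' ⊢
            have h2 : Ideal.Quotient.mk p.1 (x * z) = 0 := hy'
            rw [Ideal.Quotient.eq_zero_iff_mem] at h2 ⊢
            exact (p.2.mem_or_mem h2).resolve_left hxp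
          have hsurj : ∀ a : Abelian.Ext (ModuleCat.of R N) (ModuleCat.of R R) i,
              ∃ b : Abelian.Ext (ModuleCat.of R N) (ModuleCat.of R R) i, x • b = a := by
            intro a
            obtain ⟨b, hb⟩ := ext_lift_contra (ModuleCat.ofHom f)
              (ModuleCat.ofHom (LinearMap.range f).mkQ) hf (Submodule.mkQ_surjective _)
              (LinearMap.exact_map_mkQ_range f) _ i (ih' _) a
            refine ⟨b, ?_⟩
            rw [← hb]
            have : ModuleCat.ofHom f = x • 𝟙 (ModuleCat.of R N) := rfl
            rw [this]
            simp [Abelian.Ext.mk₀_smul]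
          have hbot : (⊤ : Submodule R (Abelian.Ext (ModuleCat.of R N) (ModuleCat.of R R) i)) = ⊥ := by
            refine Submodule.eq_bot_of_le_smul_of_le_jacobson_bot (IsLocalRing.maximalIdeal R) ⊤
              (Module.finite_def.1 inferInstance) ?_ ?_
            · intro a _
              obtain ⟨b, rfl⟩ := hsurj a
              exact Submodule.smul_mem_smul hxm trivial
            · rw [IsLocalRing.jacobson_eq_maximalIdeal _ bot_ne_top]
          intro a
          have : a ∈ (⊤ : Submodule R (Abelian.Ext (ModuleCat.of R N) (ModuleCat.of R R) i)) := trivial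
          rwa [hbot, Submodule.mem_bot] at this
      · intro N₁ _ _ _ N₂ _ _ _ N₃ _ _ _ f g hf hg hfg h1 h3
        exact ext_mid_zero (ModuleCat.ofHom f) (ModuleCat.ofHom g) hf hg hfg _ i h3 h1
  intro i hi N _ _ _ a
  by_cases h : n ≤ i
  · exact a.eq_zero_of_hasInjectiveDimensionLT n h
  · exact key (n + t - i) i (by omega) hi N a

end Stmt6

namespace Stmt6

lemma annann_mem {A : Type} [CommRing A] [IsLocalRing A] (hB : Module.Baer A A) (a0 : A)
    (ha0 : a0 ≠ 0) (hm : ∀ x ∈ IsLocalRing.maximalIdeal A, x * a0 = 0) (J : Ideal A) (x : A)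
    (hx : ∀ y, (∀ j ∈ J, y * j = 0) → y * x = 0) : x ∈ J := by
  by_contra hxJ
  have hinj := hB.injective
  let p : A →ₗ[A] A ⧸ J := LinearMap.toSpanSingleton A (A ⧸ J) (Submodule.Quotient.mk x)
  let K := LinearMap.ker p
  have hK : K ≤ LinearMap.ker (LinearMap.toSpanSingleton A A a0) := by
    intro y hy
    have hy' : y * x ∈ J := by
      have : p y = Submodule.Quotient.mk (y * x) := rfl
      rwa [← Submodule.Quotient.mk_eq_zero, ← this]
    have : y ∈ IsLocalRing.maximalIdeal A := by
      rw [IsLocalRing.mem_maximalIdeal]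
      intro hu
      exact hxJ ((Ideal.unit_mul_mem_iff_mem J hu).1 hy')
    exact hm y this
  obtain ⟨h, hh⟩ := hinj.out (K.liftQ p le_rfl)
    (LinearMap.ker_eq_bot.1 (Submodule.ker_liftQ_eq_bot _ _ _ le_rfl))
    (K.liftQ (LinearMap.toSpanSingleton A A a0) hK)
  have h1 : h (Submodule.Quotient.mk x) = a0 := by
    have h3 : h ((1 : A) • (Submodule.Quotient.mk x : A ⧸ J)) = (1 : A) • a0 :=
      hh (Submodule.Quotient.mk 1)
    rwa [one_smul, one_smul] at h3
  have h2 : ∀ z : A, h (Submodule.Quotient.mk z) = h (Submodule.Quotient.mk 1) * z := by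
    intro z
    have : (Submodule.Quotient.mk z : A ⧸ J) = z • Submodule.Quotient.mk 1 := by
      rw [← Submodule.Quotient.mk_smul]; simp
    rw [this, map_smul, smul_eq_mul, mul_comm]
  apply ha0
  rw [← h1, h2]
  apply hx
  intro j hj
  rw [← h2, (Submodule.Quotient.mk_eq_zero J).2 hj, map_zero]

lemma ringKrullDim_zero_of_baer {A : Type} [CommRing A] [IsLocalRing A] [IsNoetherianRing A]
    (hB : Module.Baer A A) (a0 : A)
    (ha0 : a0 ≠ 0) (hm : ∀ x ∈ IsLocalRing.maximalIdeal A, x * a0 = 0) : ringKrullDim A = 0 := by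
  have hanti : StrictAnti (fun J : Ideal A => Submodule.annihilator J) := by
    intro J K hJK
    refine lt_of_le_of_ne (Submodule.annihilator_mono hJK.le) ?_
    intro heq
    refine hJK.not_ge ?_
    intro x hx
    refine annann_mem hB a0 ha0 hm J x ?_
    intro y hy
    have hy' : y ∈ Submodule.annihilator J := by
      rw [Submodule.mem_annihilator]
      exact hy
    have heq' : Submodule.annihilator K = Submodule.annihilator J := heq
    rw [← heq', Submodule.mem_annihilator] at hy'
    exact hy' x hx
  have : IsArtinianRing A := by
    rw [isArtinianRing_iff, isArtinian_iff]
    exact hanti.wellFoundedLT.wf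
  exact ringKrullDimZero_iff_ringKrullDim_eq_zero.1 inferInstance

lemma socle_cyclic {A : Type} [CommRing A] [IsLocalRing A] 
    (hB : Module.Baer A A) (a0 : A)
    (ha0 : a0 ≠ 0) (hm : ∀ x ∈ IsLocalRing.maximalIdeal A, x * a0 = 0) (b : A)
    (hb : ∀ x ∈ IsLocalRing.maximalIdeal A, x * b = 0) : ∃ c, c * a0 = b := by
  rw [← Ideal.mem_span_singleton']
  refine annann_mem hB a0 ha0 hm _ b ?_
  intro y hy
  apply hb
  rw [IsLocalRing.mem_maximalIdeal]
  intro hu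
  exact ha0 ((hu.mul_right_eq_zero).1 (hy a0 (Ideal.mem_span_singleton_self a0)))

end Stmt6

namespace Stmt6

open RingTheory.Sequence in
lemma exists_max_regular {R : Type} [CommRing R] [IsLocalRing R] [IsNoetherianRing R]
    (d : ℕ) (hd : ringKrullDim R = d) :
    ∃ xs : List R, (∀ x ∈ xs, x ∈ IsLocalRing.maximalIdeal R) ∧ IsRegular R xs ∧
      ∃ ι : IsLocalRing.ResidueField R →ₗ[R] R ⧸ Ideal.ofList xs, Function.Injective ι := by
  let Sl : Set ℕ := {l | ∃ xs : List R, xs.length = l ∧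
    (∀ x ∈ xs, x ∈ IsLocalRing.maximalIdeal R) ∧ IsRegular R xs}
  have hne : Sl.Nonempty := ⟨0, [], rfl, by simp, IsRegular.nil R R⟩
  have hbdd : BddAbove Sl := by
    refine ⟨d, ?_⟩
    rintro l ⟨xs, rfl, -, hreg⟩
    have h := ringKrullDim_add_length_eq_ringKrullDim_of_isRegular xs hreg
    have hnt : Nontrivial (R ⧸ Ideal.ofList xs) := by
      rw [Ideal.Quotient.nontrivial_iff]
      have := hreg.top_ne_smul
      simpa [eq_comm] using this
    have h0 : 0 ≤ ringKrullDim (R ⧸ Ideal.ofList xs) := ringKrullDim_nonneg_of_nontrivial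
    rw [hd] at h
    have : ((xs.length : ℕ) : WithBot ℕ∞) ≤ d := by
      rw [← h]
      exact le_add_of_nonneg_left h0
    exact_mod_cast this
  obtain ⟨xs, hlen, hm, hreg⟩ := Nat.sSup_mem hne hbdd
  refine ⟨xs, hm, hreg, ?_⟩
  have hns : ¬ Subsingleton (IsLocalRing.ResidueField R →ₗ[R] R ⧸ Ideal.ofList xs) := by
    rw [IsSMulRegular.subsingleton_linearMap_iff]
    rintro ⟨r, hr, hrr⟩
    have hrm : r ∈ IsLocalRing.maximalIdeal R := by
      have := Module.mem_annihilator.1 hr 1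
      rw [← IsLocalRing.residue_eq_zero_iff]
      simpa [Algebra.smul_def] using this
    have hm' : ∀ x ∈ xs ++ [r], x ∈ IsLocalRing.maximalIdeal R := by
      intro x hx
      rcases List.mem_append.1 hx with h | h
      · exact hm x h
      · rw [List.mem_singleton.1 h]; exact hrm
    have hreg' : IsRegular R (xs ++ [r]) := by
      refine IsRegular.of_isWeaklyRegular_of_mem_maximalIdeal R hm' ?_
      rw [isWeaklyRegular_append_iff]
      refine ⟨hreg.toIsWeaklyRegular, ?_⟩
      rw [isWeaklyRegular_singleton_iff]
      refine ((Submodule.quotEquivOfEq _ (Ideal.ofList xs) (by simp)).isSMulRegular_congr r).2 hrr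
    have := le_csSup hbdd (show (xs ++ [r]).length ∈ Sl from ⟨_, rfl, hm', hreg'⟩)
    rw [← hlen] at this
    simp at this
  rw [not_subsingleton_iff_nontrivial] at hns
  obtain ⟨f, hf⟩ := exists_ne (0 : IsLocalRing.ResidueField R →ₗ[R] R ⧸ Ideal.ofList xs)
  refine ⟨f, ?_⟩
  rw [injective_iff_map_eq_zero]
  intro y hy
  by_contra hy0
  apply hf
  ext w
  obtain ⟨s, hs⟩ := IsLocalRing.residue_surjective (w * y⁻¹)
  have : w = s • y := by
    rw [Algebra.smul_def]
    change w = IsLocalRing.residue R s * y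
    rw [hs, mul_assoc, inv_mul_cancel₀ hy0, mul_one]
  rw [this, map_smul, hy, smul_zero]
  rfl

/-- The key fact about Gorenstein rings. -/
theorem gorenstein_ext {R : Type} [CommRing R] [IsLocalRing R] (hR : IsGorensteinLocalRing R)
    (d : ℕ) (hd : ringKrullDim R = d) :
    (∀ i, i ≠ d → ∀ a : Abelian.Ext (ModuleCat.of R (IsLocalRing.ResidueField R))
      (ModuleCat.of R R) i, a = 0) ∧
    Nonempty (Abelian.Ext (ModuleCat.of R (IsLocalRing.ResidueField R)) (ModuleCat.of R R) d
      ≃ₗ[R] IsLocalRing.ResidueField R) := by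
  obtain ⟨-, hN, n, hn⟩ := hR
  have hid := hasInjectiveDimensionLT_of_injDimLE n _ hn
  obtain ⟨xs, hm, hreg, ι, hι⟩ := exists_max_regular d hd
  obtain ⟨Q, ⟨eQ⟩, e, hQ1, hQ2⟩ := exists_koszul_class xs (ModuleCat.of R R)
    hreg.toIsWeaklyRegular
  let A := R ⧸ Ideal.ofList xs
  let eA : Q ≃ₗ[R] A := eQ.trans (Submodule.quotEquivOfEq _ (Ideal.ofList xs) (by simp))
  have hNT : Nontrivial A := ⟨ι 1, 0, fun h => one_ne_zero (hι (h.trans (map_zero ι).symm))⟩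
  have hloc : IsLocalRing A := .of_surjective' (Ideal.Quotient.mk (Ideal.ofList xs))
    Ideal.Quotient.mk_surjective
  have hQfin : Module.Finite R Q := Module.Finite.equiv eA.symm
  -- vanishing above
  have hv := ext_vanish_above (n + 1) hid xs.length Q
    (ModuleCat.ofHom (eA.symm.toLinearMap ∘ₗ ι)) (eA.symm.injective.comp hι)
    (fun i hi => hQ2 _ 0 (fun j hj a => by
      obtain ⟨j, rfl⟩ : ∃ j', j = j' + 1 := ⟨j - 1, by omega⟩
      exact Abelian.Ext.eq_zero_of_projective a) i (by omega))
  -- everything over `A` is killed by `xs`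
  have hkill : ∀ (x : R), x ∈ xs → ∀ a : A, x • a = 0 := by
    intro x hx a
    have h0 : Ideal.Quotient.mk (Ideal.ofList xs) x = 0 :=
      Ideal.Quotient.eq_zero_iff_mem.2 (Ideal.subset_span hx)
    have : x • a = Ideal.Quotient.mk (Ideal.ofList xs) x * a := Algebra.smul_def x a
    rw [this, h0, zero_mul]
  have hsm : ∀ (r : R) (a : A), r • a = Ideal.Quotient.mk (Ideal.ofList xs) r * a :=
    fun r a => Algebra.smul_def r a
  have hkk : ∀ x ∈ IsLocalRing.maximalIdeal R, ∀ y : IsLocalRing.ResidueField R, x • y = 0 := by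
    intro x hx y
    rw [Algebra.smul_def]
    change IsLocalRing.residue R x * y = 0
    rw [(IsLocalRing.residue_eq_zero_iff x).2 hx, zero_mul]
  have hB : Module.Baer A A := by
    intro J g
    let f : J →ₗ[R] A := J.subtype.restrictScalars R
    let C := A ⧸ LinearMap.range f
    obtain ⟨-, hbJ⟩ := hQ1 (ModuleCat.of R J) (fun x hx y => Subtype.ext (hkill x hx y))
    obtain ⟨-, hbA⟩ := hQ1 (ModuleCat.of R A) (fun x hx y => hkill x hx y)
    let φ : ModuleCat.of R J ⟶ Q := ModuleCat.ofHom (eA.symm.toLinearMap ∘ₗ g.restrictScalars R)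
    obtain ⟨b, hb⟩ := ext_lift_contra (ModuleCat.ofHom f) (ModuleCat.ofHom (LinearMap.range f).mkQ)
      Subtype.val_injective (Submodule.mkQ_surjective _) (LinearMap.exact_map_mkQ_range f) _ _
      (hv _ (Nat.lt_succ_self _) C) ((Abelian.Ext.mk₀ φ).comp e (zero_add _))
    obtain ⟨ψ, rfl⟩ := hbA.2 b
    obtain ⟨h, rfl⟩ := (Abelian.Ext.homEquiv₀ (X := ModuleCat.of R A) (Y := Q)).symm.surjective ψ
    have heq : Abelian.Ext.mk₀ (ModuleCat.ofHom f ≫ h) = Abelian.Ext.mk₀ φ := by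
      apply hbJ.1
      change _ = (Abelian.Ext.mk₀ φ).comp e (zero_add _)
      rw [← hb]
      simp
    have heq' : ModuleCat.ofHom f ≫ h = φ :=
      (Abelian.Ext.homEquiv₀ (X := ModuleCat.of R J) (Y := Q)).symm.injective heq
    refine ⟨LinearMap.extendScalarsOfSurjective
      (Ideal.Quotient.mk_surjective (I := Ideal.ofList xs)) (eA.toLinearMap ∘ₗ h.hom), ?_⟩
    intro x hx
    have h3 : h.hom x = eA.symm (g ⟨x, hx⟩) :=
      congrArg (fun q : ModuleCat.of R J ⟶ Q => q.hom ⟨x, hx⟩) heq'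
    change eA (h.hom x) = _
    rw [h3, LinearEquiv.apply_symm_apply]
  have ha0 : ι 1 ≠ 0 := fun h => one_ne_zero (hι (h.trans (map_zero ι).symm))
  have hmA : ∀ x ∈ IsLocalRing.maximalIdeal A, ∃ r ∈ IsLocalRing.maximalIdeal R,
      Ideal.Quotient.mk (Ideal.ofList xs) r = x := by
    intro x hx
    obtain ⟨r, rfl⟩ := Ideal.Quotient.mk_surjective x
    refine ⟨r, ?_, rfl⟩
    rw [IsLocalRing.mem_maximalIdeal] at hx ⊢
    exact fun hu => hx (hu.map _)
  have ham : ∀ x ∈ IsLocalRing.maximalIdeal A, x * ι 1 = 0 := by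
    intro x hx
    obtain ⟨r, hr, rfl⟩ := hmA x hx
    rw [← hsm, ← map_smul, hkk r hr, map_zero]
  have hA0 := ringKrullDim_zero_of_baer hB (ι 1) ha0 ham
  have hlen : xs.length = d := by
    have h := ringKrullDim_add_length_eq_ringKrullDim_of_isRegular xs hreg
    rw [hA0, hd, zero_add] at h
    exact_mod_cast h
  subst hlen
  obtain ⟨hk1, hk2⟩ := hQ1 (ModuleCat.of R (IsLocalRing.ResidueField R))
    (fun x hx y => hkk x (hm x hx) y)
  refine ⟨?_, ?_⟩
  · intro i hi a
    rcases lt_or_gt_of_ne hi with h | h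
    · exact hk1 i h a
    · exact hv i h _ a
  · let φ0 : ModuleCat.of R (IsLocalRing.ResidueField R) ⟶ Q :=
      ModuleCat.ofHom (eA.symm.toLinearMap ∘ₗ ι)
    let E0 := (Abelian.Ext.mk₀ φ0).comp e (zero_add xs.length)
    let p := LinearMap.toSpanSingleton R _ E0
    have hsurj : Function.Surjective p := by
      intro a
      obtain ⟨φ, rfl⟩ := hk2.2 a
      obtain ⟨h, rfl⟩ := (Abelian.Ext.homEquiv₀
        (X := ModuleCat.of R (IsLocalRing.ResidueField R)) (Y := Q)).symm.surjective φ
      obtain ⟨c, hc⟩ := socle_cyclic hB (ι 1) ha0 ham (eA (h.hom (1 : IsLocalRing.ResidueField R)))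
        (by
          intro x hx
          obtain ⟨r, hr, rfl⟩ := hmA x hx
          rw [← hsm, ← map_smul, ← map_smul]
          have : r • (1 : IsLocalRing.ResidueField R) = 0 := hkk r hr 1
          exact (congrArg (fun z => eA (h.hom z)) this).trans (by simp))
      obtain ⟨r, rfl⟩ := Ideal.Quotient.mk_surjective c
      have hh : h = r • φ0 := by
        ext w
        obtain ⟨s, rfl⟩ := IsLocalRing.residue_surjective w
        have h1 : h.hom (1 : IsLocalRing.ResidueField R) = r • eA.symm (ι 1) := by
          apply eA.injective
          rw [← hc, map_smul, LinearEquiv.apply_symm_apply, hsm]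
        have h2 : IsLocalRing.residue R s = s • (1 : IsLocalRing.ResidueField R) := by
          rw [Algebra.smul_def, mul_one]; rfl
        change h.hom (IsLocalRing.residue R s) = r • eA.symm (ι (IsLocalRing.residue R s))
        rw [h2, map_smul, map_smul, map_smul, smul_comm r s]
        exact congrArg (s • ·) h1
      refine ⟨r, ?_⟩
      change r • E0 = (Abelian.Ext.mk₀ h).comp e _
      rw [hh, Abelian.Ext.mk₀_smul, Abelian.Ext.smul_comp]
    have hker : LinearMap.ker p = IsLocalRing.maximalIdeal R := by
      ext r
      constructor
      · intro hr
        have hr' : r • E0 = 0 := hr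
        rw [IsLocalRing.mem_maximalIdeal]
        intro hu
        have hE : E0 = 0 := (hu.smul_eq_zero).1 hr'
        have : Abelian.Ext.mk₀ φ0 = 0 := by
          apply hk2.1
          change E0 = Abelian.Ext.comp 0 e _
          rw [hE, Abelian.Ext.zero_comp]
        have h0 : φ0 = 0 := (Abelian.Ext.homEquiv₀
          (X := ModuleCat.of R (IsLocalRing.ResidueField R)) (Y := Q)).symm.injective
          (this.trans (Abelian.Ext.mk₀_zero _ _).symm)
        have h1 : eA.symm (ι 1) = 0 := congrArg (fun q : ModuleCat.of R
          (IsLocalRing.ResidueField R) ⟶ Q => q.hom (1 : IsLocalRing.ResidueField R)) h0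
        exact ha0 (by simpa using h1)
      · intro hr
        exact ext_smul_eq_zero_left (fun y => hkk r hr y) E0
    exact ⟨((Submodule.quotEquivOfEq _ _ hker).symm.trans
      (p.quotKerEquivOfSurjective hsurj)).symm⟩

end Stmt6

namespace Stmt6

/-- cokernels of the differentials -/
abbrev Oc {R : Type} [CommRing R] (K : ChainComplex (ModuleCat.{0} R) ℤ) (n : ℤ) : ModuleCat.{0} R :=
  ModuleCat.of R (K.X n ⧸ LinearMap.range (K.d (n + 1) n).hom)

abbrev OcToX {R : Type} [CommRing R] (K : ChainComplex (ModuleCat.{0} R) ℤ) (n : ℤ) :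
    Oc K (n + 1) ⟶ K.X n :=
  ModuleCat.ofHom (Submodule.liftQ _ (K.d (n + 1) n).hom (by
    rintro _ ⟨x, rfl⟩
    have := K.d_comp_d (n + 1 + 1) (n + 1) n
    exact congrArg (fun f : K.X (n + 1 + 1) ⟶ K.X n => f.hom x) this))

abbrev XToOc {R : Type} [CommRing R] (K : ChainComplex (ModuleCat.{0} R) ℤ) (n : ℤ) :
    K.X n ⟶ Oc K n :=
  ModuleCat.ofHom (Submodule.mkQ _)

lemma oc_ses {R : Type} [CommRing R] (K : ChainComplex (ModuleCat.{0} R) ℤ) (n : ℤ)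
    (h : K.ExactAt (n + 1)) :
    ∃ w : OcToX K n ≫ XToOc K n = 0, (ShortComplex.mk (OcToX K n) (XToOc K n) w).ShortExact := by
  refine shortExact_mk _ _ ?_ (Submodule.mkQ_surjective _) ?_
  · have hE := exactAt_function K (n + 1 + 1) (n + 1) n (by simp) (by simp) h
    refine LinearMap.ker_eq_bot.1 (Submodule.ker_liftQ_eq_bot _ _ _ ?_)
    intro x hx
    exact (hE x).1 hx
  · intro x
    change (Submodule.mkQ (LinearMap.range (K.d (n + 1) n).hom)) x = 0 ↔ _
    rw [Submodule.mkQ_apply, Submodule.Quotient.mk_eq_zero]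
    constructor
    · rintro ⟨y, rfl⟩
      exact ⟨Submodule.Quotient.mk y, rfl⟩
    · rintro ⟨y, rfl⟩
      obtain ⟨y, rfl⟩ := Submodule.mkQ_surjective _ y
      exact ⟨y, rfl⟩

lemma ext_cov_iso {R : Type} [CommRing R] {S : ShortComplex (ModuleCat.{0} R)} (hS : S.ShortExact)
    (X : ModuleCat.{0} R) (q : ℕ) (h1 : ∀ a : Abelian.Ext X S.X₂ q, a = 0)
    (h2 : ∀ a : Abelian.Ext X S.X₂ (q + 1), a = 0) :
    Nonempty (Abelian.Ext X S.X₃ q ≃ₗ[R] Abelian.Ext X S.X₁ (q + 1)) := by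
  refine ⟨LinearEquiv.ofBijective (hS.extClass.postcompOfLinear R X (rfl : q + 1 = q + 1)) ⟨?_, ?_⟩⟩
  · rw [injective_iff_map_eq_zero]
    intro b hb
    obtain ⟨c, hc⟩ := Abelian.Ext.covariant_sequence_exact₃ X hS b rfl hb
    rw [← hc, h1 c, Abelian.Ext.zero_comp]
  · intro a
    exact Abelian.Ext.covariant_sequence_exact₁ X hS a (h2 _) rfl

lemma ext_con_iso {R : Type} [CommRing R] {S : ShortComplex (ModuleCat.{0} R)} (hS : S.ShortExact)
    (Y : ModuleCat.{0} R) (q : ℕ) (h1 : ∀ a : Abelian.Ext S.X₂ Y q, a = 0)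
    (h2 : ∀ a : Abelian.Ext S.X₂ Y (q + 1), a = 0) :
    Nonempty (Abelian.Ext S.X₁ Y q ≃ₗ[R] Abelian.Ext S.X₃ Y (q + 1)) := by
  refine ⟨LinearEquiv.ofBijective (hS.extClass.precompOfLinear R Y (add_comm 1 q)) ⟨?_, ?_⟩⟩
  · rw [injective_iff_map_eq_zero]
    intro b hb
    obtain ⟨c, hc⟩ := Abelian.Ext.contravariant_sequence_exact₁ hS Y b (add_comm 1 q) hb
    rw [← hc, h1 c, Abelian.Ext.comp_zero]
  · intro a
    exact Abelian.Ext.contravariant_sequence_exact₃ hS Y a (h2 _) (add_comm 1 q)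

/-- isomorphisms of modules induce isomorphisms on `Ext`. -/
lemma ext_congr_right {R : Type} [CommRing R] {Y Y' : ModuleCat.{0} R} (e : Y ≅ Y')
    (X : ModuleCat.{0} R) (q : ℕ) :
    Nonempty (Abelian.Ext X Y q ≃ₗ[R] Abelian.Ext X Y' q) := by
  refine ⟨LinearEquiv.ofLinearMap ((Abelian.Ext.mk₀ e.hom).postcompOfLinear R X (add_zero q))
    ((Abelian.Ext.mk₀ e.inv).postcompOfLinear R X (add_zero q)) ?_ ?_⟩
  · ext a
    change (a.comp (Abelian.Ext.mk₀ e.inv) (add_zero q)).comp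
      (Abelian.Ext.mk₀ e.hom) (add_zero q) = a
    simp
  · ext a
    change (a.comp (Abelian.Ext.mk₀ e.hom) (add_zero q)).comp
      (Abelian.Ext.mk₀ e.inv) (add_zero q) = a
    simp

lemma ext_congr_left {R : Type} [CommRing R] {X X' : ModuleCat.{0} R} (e : X ≅ X')
    (Y : ModuleCat.{0} R) (q : ℕ) :
    Nonempty (Abelian.Ext X Y q ≃ₗ[R] Abelian.Ext X' Y q) := by
  refine ⟨LinearEquiv.ofLinearMap ((Abelian.Ext.mk₀ e.inv).precompOfLinear R Y (zero_add q))
    ((Abelian.Ext.mk₀ e.hom).precompOfLinear R Y (zero_add q)) ?_ ?_⟩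
  · ext a
    change (Abelian.Ext.mk₀ e.inv).comp ((Abelian.Ext.mk₀ e.hom).comp a (zero_add q)) (zero_add q) = a
    simp
  · ext a
    change (Abelian.Ext.mk₀ e.hom).comp ((Abelian.Ext.mk₀ e.inv).comp a (zero_add q)) (zero_add q) = a
    simp

lemma oc_cov_shift {R : Type} [CommRing R] (K : ChainComplex (ModuleCat.{0} R) ℤ)
    (X : ModuleCat.{0} R) (q : ℕ) (n : ℤ) (hK : ∀ m, n < m → K.ExactAt m)
    (h : ∀ p, q ≤ p → ∀ m, ∀ a : Abelian.Ext X (K.X m) p, a = 0) (s : ℕ) :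
    Nonempty (Abelian.Ext X (Oc K n) q ≃ₗ[R] Abelian.Ext X (Oc K (n + s)) (q + s)) := by
  induction s with
  | zero => 
    have : n + ((0 : ℕ) : ℤ) = n := by simp
    rw [this]
    exact ⟨LinearEquiv.refl R _⟩
  | succ s ih =>
    obtain ⟨w, hS⟩ := oc_ses K (n + s) (hK _ (by omega))
    obtain ⟨e⟩ := ih
    obtain ⟨e'⟩ := ext_cov_iso hS X (q + s) (h _ (by omega) _) (h _ (by omega) _)
    have : n + ((s + 1 : ℕ) : ℤ) = n + s + 1 := by push_cast; ring
    rw [this]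
    exact ⟨e.trans e'⟩

lemma oc_con_shift {R : Type} [CommRing R] (K : ChainComplex (ModuleCat.{0} R) ℤ)
    (hproj : ∀ i, Projective (K.X i))
    (Y : ModuleCat.{0} R) (n : ℤ) (hK : ∀ m, n < m → K.ExactAt m) (s : ℕ) :
    Nonempty (Abelian.Ext (Oc K n) Y (s + 1) ≃ₗ[R] Abelian.Ext (Oc K (n + s)) Y 1) := by
  induction s generalizing n with
  | zero =>
    have : n + ((0 : ℕ) : ℤ) = n := by simp
    rw [this]
    exact ⟨LinearEquiv.refl R _⟩
  | succ s ih =>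
    obtain ⟨w, hS⟩ := oc_ses K n (hK _ (by omega))
    obtain ⟨e⟩ := ih (n + 1) (fun m hm => hK m (by omega))
    have := hproj n
    obtain ⟨e'⟩ := ext_con_iso hS Y (s + 1) (fun a => Abelian.Ext.eq_zero_of_projective (P := K.X n) a)
      (fun a => Abelian.Ext.eq_zero_of_projective (P := K.X n) a)
    have : n + ((s + 1 : ℕ) : ℤ) = n + 1 + s := by push_cast; ring
    rw [this]
    exact ⟨e'.symm.trans e⟩

/-- computing homology of a complex of modules -/
lemma homology_equiv {R : Type} [CommRing R] (L : CochainComplex (ModuleCat.{0} R) ℤ) (i j k : ℤ)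
    (hij : i + 1 = j) (hjk : j + 1 = k) {V W : Type} [AddCommGroup V] [Module R V]
    [AddCommGroup W] [Module R W] (c : W →ₗ[R] L.X j)
    (hc : LinearMap.range c = LinearMap.ker (L.d j k).hom)
    (p : W →ₗ[R] V) (hp : Function.Surjective p)
    (hker : ∀ x, p x = 0 ↔ ∃ y, (L.d i j).hom y = c x) :
    Nonempty (L.homology j ≃ₗ[R] V) := by
  let S := L.sc' i j k
  let e1 : L.homology j ≅ S.homology := ShortComplex.homologyMapIso
    (L.isoSc' i j k (by simp [← hij]) (by simp [hjk]))
  let e2 : S.homology ≅ S.moduleCatLeftHomologyData.H := S.moduleCatHomologyIso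
  let c' : W →ₗ[R] LinearMap.ker S.g.hom := LinearMap.codRestrict _ c (fun x => by
    have : c x ∈ LinearMap.ker (L.d j k).hom := hc ▸ LinearMap.mem_range_self c x
    exact this)
  have hc' : Function.Surjective c' := by
    rintro ⟨y, hy⟩
    have : y ∈ LinearMap.range c := by rw [hc]; exact hy
    obtain ⟨x, hx⟩ := this
    exact ⟨x, Subtype.ext hx⟩
  let q : W →ₗ[R] (LinearMap.ker S.g.hom) ⧸ LinearMap.range S.moduleCatToCycles :=
    (Submodule.mkQ _) ∘ₗ c'
  have hq : Function.Surjective q := (Submodule.mkQ_surjective _).comp hc'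
  have hkq : LinearMap.ker q = LinearMap.ker p := by
    ext x
    rw [LinearMap.mem_ker, LinearMap.mem_ker, hker]
    change Submodule.Quotient.mk (c' x) = 0 ↔ _
    rw [Submodule.Quotient.mk_eq_zero]
    constructor
    · rintro ⟨y, hy⟩
      exact ⟨y, congrArg Subtype.val hy⟩
    · rintro ⟨y, hy⟩
      exact ⟨y, Subtype.ext hy⟩
  let e3 := (q.quotKerEquivOfSurjective hq).symm.trans
    ((Submodule.quotEquivOfEq _ _ hkq).trans (p.quotKerEquivOfSurjective hp))
  exact ⟨(e1 ≪≫ e2).toLinearEquiv.trans e3⟩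

lemma homology_yoneda {R : Type} [CommRing R] (K : ChainComplex (ModuleCat.{0} R) ℤ)
    (hproj : ∀ i, Projective (K.X i)) (Y : ModuleCat.{0} R) (n : ℤ) (hK : K.ExactAt (n + 1)) :
    Nonempty ((K.linearYonedaObj R Y).homology (n + 1) ≃ₗ[R] Abelian.Ext (Oc K n) Y 1) := by
  obtain ⟨w, hS⟩ := oc_ses K n hK
  have hP := hproj n
  let c : (Oc K (n + 1) ⟶ Y) →ₗ[R] (K.X (n + 1) ⟶ Y) := Linear.leftComp R Y (XToOc K (n + 1))
  let p : (Oc K (n + 1) ⟶ Y) →ₗ[R] Abelian.Ext (Oc K n) Y 1 :=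
    (hS.extClass.precompOfLinear R Y (add_zero 1)) ∘ₗ
      (Abelian.Ext.linearEquiv₀ (R := R) (X := Oc K (n + 1)) (Y := Y)).symm.toLinearMap
  have hinj : Function.Injective c := by
    intro f g hfg
    ext x
    exact congrArg (fun h : K.X (n + 1) ⟶ Y => h.hom x) hfg
  refine homology_equiv (K.linearYonedaObj R Y) n (n + 1) (n + 1 + 1) rfl rfl c ?_ p ?_ ?_
  · ext f
    change (K.X (n + 1) ⟶ Y) at f
    constructor
    · rintro ⟨g, rfl⟩
      change K.d (n + 1 + 1) (n + 1) ≫ XToOc K (n + 1) ≫ g = 0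
      have : K.d (n + 1 + 1) (n + 1) ≫ XToOc K (n + 1) = 0 := by
        ext x
        exact (Submodule.Quotient.mk_eq_zero _).2 ⟨x, rfl⟩
      rw [← Category.assoc, this, zero_comp]
    · intro hf
      have hf' : K.d (n + 1 + 1) (n + 1) ≫ f = 0 := hf
      refine ⟨ModuleCat.ofHom (Submodule.liftQ _ f.hom ?_), ?_⟩
      · rintro _ ⟨x, rfl⟩
        exact congrArg (fun h : K.X (n + 1 + 1) ⟶ Y => h.hom x) hf'
      · change XToOc K (n + 1) ≫ _ = f
        ext x
        rfl
  · intro a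
    obtain ⟨b, hb⟩ := Abelian.Ext.contravariant_sequence_exact₃ hS Y a
      (Abelian.Ext.eq_zero_of_projective (P := K.X n) _) (add_zero 1)
    obtain ⟨f, rfl⟩ := (Abelian.Ext.linearEquiv₀ (R := R) (X := Oc K (n + 1)) (Y := Y)).symm.surjective b
    exact ⟨f, hb⟩
  · intro f
    constructor
    · intro hf
      obtain ⟨b, hb⟩ := Abelian.Ext.contravariant_sequence_exact₁ hS Y (Abelian.Ext.mk₀ f)
        (add_zero 1) hf
      obtain ⟨g, rfl⟩ := (Abelian.Ext.linearEquiv₀ (R := R) (X := K.X n) (Y := Y)).symm.surjective b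
      have h2 : OcToX K n ≫ g = f := by
        apply (Abelian.Ext.linearEquiv₀ (R := R) (X := Oc K (n + 1)) (Y := Y)).symm.injective
        refine Eq.trans ?_ hb
        exact (Abelian.Ext.mk₀_comp_mk₀ _ _).symm
      refine ⟨g, ?_⟩
      rw [← h2]
      change K.d (n + 1) n ≫ g = XToOc K (n + 1) ≫ OcToX K n ≫ g
      rfl
    · rintro ⟨g, hg⟩
      change K.X n ⟶ Y at g
      have hg' : K.d (n + 1) n ≫ g = XToOc K (n + 1) ≫ f := hg
      have h2 : OcToX K n ≫ g = f := by
        apply hinj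
        exact hg'
      change hS.extClass.comp (Abelian.Ext.mk₀ f) (add_zero 1) = 0
      rw [← h2, ← Abelian.Ext.mk₀_comp_mk₀]
      exact hS.extClass_comp_assoc _

end Stmt6

namespace Stmt6

lemma free_of_proj {R : Type} [CommRing R] [IsLocalRing R] (F : ModuleCat.{0} R)
    [Projective F] [Module.Finite R F] : Module.Free R F := by
  have : Module.Projective R F := (IsProjective.iff_projective F).2 inferInstance
  exact Module.free_of_flat_of_isLocalRing

abbrev coordHom {R : Type} [CommRing R] {F : ModuleCat.{0} R} {ι : Type} (b : Module.Basis ι R F)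
    (i : ι) : F ⟶ ModuleCat.of R R := ModuleCat.ofHom (b.coord i)

abbrev vecHom {R : Type} [CommRing R] {F : ModuleCat.{0} R} (x : F) : ModuleCat.of R R ⟶ F :=
  ModuleCat.ofHom (LinearMap.toSpanSingleton R F x)

lemma basis_id {R : Type} [CommRing R] {F : ModuleCat.{0} R} {ι : Type} [Fintype ι]
    (b : Module.Basis ι R F) : ∑ i, coordHom b i ≫ vecHom (b i) = 𝟙 F := by
  ext x
  rw [ModuleCat.hom_sum, LinearMap.sum_apply]
  exact b.sum_repr x

lemma mk₀_sum' {R : Type} [CommRing R] {X Y : ModuleCat.{0} R} {ι : Type} (s : Finset ι)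
    (f : ι → (X ⟶ Y)) : Abelian.Ext.mk₀ (∑ i ∈ s, f i) = ∑ i ∈ s, Abelian.Ext.mk₀ (f i) :=
  map_sum (Abelian.Ext.linearEquiv₀ (R := R) (X := X) (Y := Y)).symm f s

lemma comp_sum' {R : Type} [CommRing R] {X Y Z : ModuleCat.{0} R} {ι : Type} (s : Finset ι)
    {n m l : ℕ} (h : n + m = l) (a : Abelian.Ext X Y n)
    (f : ι → Abelian.Ext Y Z m) : a.comp (∑ i ∈ s, f i) h = ∑ i ∈ s, a.comp (f i) h :=
  map_sum (a.precompOfLinear R Z h) f s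

lemma sum_comp' {R : Type} [CommRing R] {X Y Z : ModuleCat.{0} R} {ι : Type} (s : Finset ι)
    {n m l : ℕ} (h : n + m = l) (a : ι → Abelian.Ext X Y n)
    (f : Abelian.Ext Y Z m) : (∑ i ∈ s, a i).comp f h = ∑ i ∈ s, (a i).comp f h :=
  map_sum (f.postcompOfLinear R X h) a s

lemma ext_basis_expand {R : Type} [CommRing R] {X F : ModuleCat.{0} R} {ι : Type} [Fintype ι]
    (b : Module.Basis ι R F) {p : ℕ} (a : Abelian.Ext X F p) :
    ∑ i, (a.comp (Abelian.Ext.mk₀ (coordHom b i)) (add_zero p)).comp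
      (Abelian.Ext.mk₀ (vecHom (b i))) (add_zero p) = a := by
  conv_rhs => rw [← Abelian.Ext.comp_mk₀_id a, ← basis_id b, mk₀_sum', comp_sum']
  refine Finset.sum_congr rfl fun i _ => ?_
  rw [← Abelian.Ext.mk₀_comp_mk₀]
  simp

lemma ext_free_zero {R : Type} [CommRing R] [IsLocalRing R] (X F : ModuleCat.{0} R)
    [Projective F] [Module.Finite R F] (p : ℕ)
    (h : ∀ a : Abelian.Ext X (ModuleCat.of R R) p, a = 0) (a : Abelian.Ext X F p) : a = 0 := by
  have := free_of_proj F
  rw [← ext_basis_expand (Module.Free.chooseBasis R F) a]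
  refine Finset.sum_eq_zero fun i _ => ?_
  rw [h (a.comp (Abelian.Ext.mk₀ (coordHom _ i)) (add_zero p)), Abelian.Ext.zero_comp]

/-- cokernels agree where the comparison map is an isomorphism -/
lemma oc_iso {R : Type} [CommRing R] {K L : ChainComplex (ModuleCat.{0} R) ℤ} (θ : K ⟶ L) (n : ℤ)
    (h0 : IsIso (θ.f n)) (h1 : IsIso (θ.f (n + 1))) : Nonempty (Oc K n ≅ Oc L n) := by
  let e := (asIso (θ.f n)).toLinearEquiv
  have hb := (ConcreteCategory.isIso_iff_bijective (θ.f (n + 1))).1 h1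
  refine ⟨(Submodule.Quotient.equiv _ _ e ?_).toModuleIso⟩
  have hcomm : ∀ x, (θ.f n).hom ((K.d (n + 1) n).hom x) = (L.d (n + 1) n).hom ((θ.f (n + 1)).hom x) :=
    fun x => congrArg (fun q : K.X (n + 1) ⟶ L.X n => q.hom x) (θ.comm (n + 1) n).symm
  ext y
  constructor
  · rintro ⟨_, ⟨x, rfl⟩, rfl⟩
    exact ⟨(θ.f (n + 1)).hom x, (hcomm x).symm⟩
  · rintro ⟨z, rfl⟩
    obtain ⟨x, rfl⟩ := hb.2 z
    exact ⟨(K.d (n + 1) n).hom x, ⟨x, rfl⟩, hcomm x⟩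

lemma oc_zero_iso {R : Type} [CommRing R] {M : ModuleCat.{0} R} (C : CompleteResolution R M) :
    Nonempty (Oc C.P 0 ≅ M) := by
  have hE := (ShortComplex.ShortExact.moduleCat_exact_iff_function_exact _).1 C.exact0
  have hs := (ModuleCat.epi_iff_surjective C.π).1 C.epiπ
  have : LinearMap.range (C.P.d (0 + 1) 0).hom = LinearMap.ker C.π.hom := by
    ext x
    exact (hE x).symm
  exact ⟨((Submodule.quotEquivOfEq _ _ this).trans
    (C.π.hom.quotKerEquivOfSurjective hs)).toModuleIso⟩

/-- `Ext` of the syzygies of a totally acyclic complex into projectives vanishes. -/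
lemma oc_ext_free_zero {R : Type} [CommRing R] [IsLocalRing R] {M : ModuleCat.{0} R}
    (C : CompleteResolution R M) (n : ℤ) (p : ℕ) (hp : 1 ≤ p) (F : ModuleCat.{0} R)
    [Projective F] [Module.Finite R F] (a : Abelian.Ext (Oc C.T n) F p) : a = 0 := by
  refine ext_free_zero _ _ _ ?_ a
  obtain ⟨s, rfl⟩ : ∃ s, p = s + 1 := ⟨p - 1, by omega⟩
  obtain ⟨e⟩ := oc_con_shift C.T C.projT (ModuleCat.of R R) n (fun m _ => C.exactT m) s
  obtain ⟨e'⟩ := homology_yoneda C.T C.projT (ModuleCat.of R R) (n + s) (C.exactT _)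
  have h0 := (HomologicalComplex.exactAt_iff_isZero_homology _ _).1 (C.exactTdual (n + s + 1))
  have := ModuleCat.subsingleton_of_isZero h0
  intro b
  apply (e.trans e'.symm).injective
  exact Subsingleton.elim _ _

theorem tate_to_ext {R : Type} [CommRing R] [IsLocalRing R] (hR : IsGorensteinLocalRing R)
    (d : ℕ) (hd : ringKrullDim R = d) (M : ModuleCat.{0} R) (CM : CompleteResolution R M)
    (Ck : CompleteResolution R (ModuleCat.of R (IsLocalRing.ResidueField R))) (i : ℤ) :
    Nonempty (TateExt R Ck M ((d : ℤ) - i - 1) ≃ₗ[R]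
      Abelian.Ext (ModuleCat.of R (IsLocalRing.ResidueField R)) (Oc CM.T (i + 2)) (d + 1)) := by
  obtain ⟨hG, -⟩ := gorenstein_ext hR d hd
  obtain ⟨n1, h1⟩ := CM.iso_eventually
  obtain ⟨n2, h2⟩ := Ck.iso_eventually
  let k := ModuleCat.of R (IsLocalRing.ResidueField R)
  -- a large integer
  obtain ⟨n, hn1, hn2, hn3, hn4⟩ : ∃ n : ℕ, n1 ≤ n ∧ n2 ≤ (d : ℤ) - i - 1 - 1 + n ∧
      1 ≤ (d : ℤ) - i - 1 + n ∧ i + 2 ≤ n := by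
    refine ⟨(max n1 (max (n2 - ((d : ℤ) - i - 1 - 1)) (max (1 - ((d : ℤ) - i - 1)) (i + 2)))).toNat,
      ?_, ?_, ?_, ?_⟩ <;> omega
  generalize hj : (d : ℤ) - i - 1 - 1 = j at hn2
  have hj' : (d : ℤ) - i - 1 = j + 1 := by omega
  rw [hj']
  obtain ⟨e1⟩ := homology_yoneda Ck.T Ck.projT M j (Ck.exactT _)
  obtain ⟨i2⟩ := oc_zero_iso CM
  obtain ⟨e2⟩ := ext_congr_right i2.symm (Oc Ck.T j) 1
  obtain ⟨e3⟩ := oc_cov_shift CM.P (Oc Ck.T j) 1 0 (fun m hm => CM.exactP m hm)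
    (fun p hp m a => by
      have := CM.projP m
      have := CM.fgP m
      exact oc_ext_free_zero Ck j p hp _ a) n
  obtain ⟨i4⟩ := oc_iso CM.θ (0 + n) (h1 _ (by omega)) (h1 _ (by omega))
  obtain ⟨e4⟩ := ext_congr_right i4.symm (Oc Ck.T j) (1 + n)
  obtain ⟨e5⟩ := oc_con_shift Ck.T Ck.projT (Oc CM.T (0 + n)) j (fun m _ => Ck.exactT m) n
  obtain ⟨i6⟩ := oc_iso Ck.θ (j + n) (h2 _ (by omega)) (h2 _ (by omega))
  obtain ⟨e6⟩ := ext_congr_left i6 (Oc CM.T (0 + n)) 1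
  obtain ⟨s, hs⟩ : ∃ s : ℕ, j + n = 0 + s := ⟨(j + n).toNat, by omega⟩
  obtain ⟨e7⟩ := oc_con_shift Ck.P Ck.projP (Oc CM.T (0 + n)) 0 (fun m hm => Ck.exactP m hm) s
  obtain ⟨i8⟩ := oc_zero_iso Ck
  obtain ⟨e8⟩ := ext_congr_left i8 (Oc CM.T (0 + n)) (s + 1)
  obtain ⟨r, hr⟩ : ∃ r : ℕ, i + 2 + r = n := ⟨(n - (i + 2)).toNat, by omega⟩
  obtain ⟨e9⟩ := oc_cov_shift CM.T k (d + 1) (i + 2) (fun m _ => CM.exactT m)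
    (fun p hp m a => by
      have := CM.projT m
      have := CM.fgT m
      exact ext_free_zero k _ p (hG p (by omega)) a) r
  have hs' : d + 1 + r = s + 1 := by omega
  rw [hs', show i + 2 + (r : ℤ) = 0 + n by omega] at e9
  rw [← hs] at e7
  rw [add_comm 1 n] at e3 e4
  exact ⟨e1.trans (e2.trans (e3.trans (e4.trans (e5.trans (e6.trans (e7.symm.trans
    (e8.trans e9.symm)))))))⟩

end Stmt6

namespace Stmt6

lemma length_formula {R : Type} [CommRing R] {X0 X X1 V W : Type} [AddCommGroup X0] [Module R X0]
    [AddCommGroup X] [Module R X] [AddCommGroup X1] [Module R X1] [AddCommGroup V] [Module R V]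
    [AddCommGroup W] [Module R W] (a : X0 →ₗ[R] X) (b : X →ₗ[R] X1) (c : W →ₗ[R] X)
    (hc : Function.Injective c)
    (hcb : LinearMap.range c = LinearMap.ker b) (hab : ∀ x, b (a x) = 0)
    (p : W →ₗ[R] V) (hp : Function.Surjective p)
    (hker : ∀ x, p x = 0 ↔ ∃ y, a y = c x) :
    Module.length R V + Module.length R (LinearMap.range a) + Module.length R (LinearMap.range b)
      = Module.length R X := by
  have h1 : Module.length R X = Module.length R W + Module.length R (LinearMap.range b) := by
    refine Module.length_eq_add_of_exact c b.rangeRestrict hc b.surjective_rangeRestrict ?_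
    intro x
    rw [← LinearMap.mem_ker, LinearMap.ker_rangeRestrict, ← hcb]
    rfl
  have hle : LinearMap.range a ≤ LinearMap.range c := by
    rintro _ ⟨x, rfl⟩
    rw [hcb]
    exact hab x
  let e := LinearEquiv.ofInjective c hc
  let g : LinearMap.range a →ₗ[R] W := e.symm.toLinearMap ∘ₗ Submodule.inclusion hle
  have hg : ∀ y, c (g y) = y := fun y => by
    have := congrArg Subtype.val (e.apply_symm_apply (Submodule.inclusion hle y))
    exact this
  have h2 : Module.length R W = Module.length R (LinearMap.range a) + Module.length R V := by
    refine Module.length_eq_add_of_exact g p ?_ hp ?_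
    · intro x y hxy
      apply Subtype.ext
      rw [← hg x, ← hg y, hxy]
    · intro x
      rw [hker]
      constructor
      · rintro ⟨y, hy⟩
        exact ⟨⟨a y, y, rfl⟩, hc (by rw [hg]; exact hy)⟩
      · rintro ⟨⟨_, y, rfl⟩, rfl⟩
        exact ⟨y, (hg ⟨a y, y, rfl⟩).symm⟩
  rw [h1, h2]
  ring

lemma killed_equiv {R : Type} [CommRing R] [IsLocalRing R] {V : Type} [AddCommGroup V] [Module R V]
    (hk : ∀ x ∈ IsLocalRing.maximalIdeal R, ∀ v : V, x • v = 0) (hf : Module.length R V ≠ ⊤) :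
    ∃ n : ℕ, Module.length R V = n ∧ Nonempty (V ≃ₗ[R] (Fin n → IsLocalRing.ResidueField R)) := by
  letI : Module (IsLocalRing.ResidueField R) V := 
    Module.IsTorsionBySet.module (R := R) (I := IsLocalRing.maximalIdeal R) (fun v x => hk x x.2 v)
  haveI : IsScalarTower R (IsLocalRing.ResidueField R) V :=
    Module.IsTorsionBySet.isScalarTower (R := R) (I := IsLocalRing.maximalIdeal R) (fun v x => hk x x.2 v)
  have hs : Function.Surjective (algebraMap R (IsLocalRing.ResidueField R)) := Ideal.Quotient.mk_surjective
  have hlen : Module.length R V = Module.length (IsLocalRing.ResidueField R) V :=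
    (Module.length_eq_of_surjective hs)
  rw [hlen] at hf ⊢
  have hfl := Module.length_ne_top_iff.1 hf
  have hN := (isFiniteLength_iff_isNoetherian_isArtinian.1 hfl).1
  refine ⟨Module.finrank (IsLocalRing.ResidueField R) V, Module.length_eq_finrank _ _, 
    ⟨(Module.finBasis (IsLocalRing.ResidueField R) V).equivFun.restrictScalars R⟩⟩

lemma killed_iso {R : Type} [CommRing R] [IsLocalRing R] {V V' : Type} [AddCommGroup V] [Module R V]
    [AddCommGroup V'] [Module R V']
    (hk : ∀ x ∈ IsLocalRing.maximalIdeal R, ∀ v : V, x • v = 0)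
    (hk' : ∀ x ∈ IsLocalRing.maximalIdeal R, ∀ v : V', x • v = 0)
    (hf : Module.length R V ≠ ⊤) (h : Module.length R V = Module.length R V') :
    Nonempty (V ≃ₗ[R] V') := by
  obtain ⟨n, hn, ⟨e⟩⟩ := killed_equiv hk hf
  obtain ⟨n', hn', ⟨e'⟩⟩ := killed_equiv hk' (h ▸ hf)
  have : n = n' := by
    rw [hn, hn'] at h
    exact_mod_cast h
  subst this
  exact ⟨e.trans e'.symm⟩

lemma length_range_congr {R : Type} [CommRing R] {A B A' B' : Type} [AddCommGroup A] [Module R A]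
    [AddCommGroup B] [Module R B] [AddCommGroup A'] [Module R A'] [AddCommGroup B'] [Module R B']
    (f : A →ₗ[R] B) (g : A' →ₗ[R] B') (e1 : A ≃ₗ[R] A') (e2 : B ≃ₗ[R] B')
    (h : ∀ x, e2 (f x) = g (e1 x)) :
    Module.length R (LinearMap.range f) = Module.length R (LinearMap.range g) := by
  have : (LinearMap.range f).map e2.toLinearMap = LinearMap.range g := by
    ext y
    constructor
    · rintro ⟨_, ⟨x, rfl⟩, rfl⟩
      exact ⟨e1 x, (h x).symm⟩
    · rintro ⟨x, rfl⟩
      refine ⟨f (e1.symm x), ⟨_, rfl⟩, ?_⟩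
      have := h (e1.symm x)
      rw [e1.apply_symm_apply] at this
      exact this
  rw [← this]
  exact (e2.submoduleMap _).length_eq

lemma length_range_matrix {R : Type} [CommRing R] [IsLocalRing R] {ι ι' : Type} [Fintype ι]
    [Fintype ι'] (A : Matrix ι' ι (IsLocalRing.ResidueField R)) :
    Module.length R (LinearMap.range (A.mulVecLin.restrictScalars R)) = A.rank := by
  have hs : Function.Surjective (algebraMap R (IsLocalRing.ResidueField R)) := Ideal.Quotient.mk_surjective
  have h1 : Module.length R (LinearMap.range A.mulVecLin) =
      Module.length (IsLocalRing.ResidueField R) (LinearMap.range A.mulVecLin) :=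
    Module.length_eq_of_surjective hs
  rw [Matrix.rank, ← Module.length_eq_finrank, ← h1]
  rfl

lemma length_pi_residue {R : Type} [CommRing R] [IsLocalRing R] {ι : Type} [Fintype ι] :
    Module.length R (ι → IsLocalRing.ResidueField R) ≠ ⊤ := by
  have hs : Function.Surjective (algebraMap R (IsLocalRing.ResidueField R)) := Ideal.Quotient.mk_surjective
  have h1 : Module.length R (ι → IsLocalRing.ResidueField R) =
      Module.length (IsLocalRing.ResidueField R) (ι → IsLocalRing.ResidueField R) :=
    Module.length_eq_of_surjective hs
  rw [h1]
  exact Module.length_ne_top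

/-- `Hom(F,k) ≃ k^ι` -/
def homEquiv {R : Type} [CommRing R] {F : ModuleCat.{0} R} {ι : Type} [Fintype ι]
    (b : Module.Basis ι R F) (Y : ModuleCat.{0} R) : (F ⟶ Y) ≃ₗ[R] (ι → Y) :=
  (ModuleCat.homLinearEquiv (S := R)).trans (b.constr R).symm

/-- `Ext^d(k,F) ≃ k^ι` -/
def extEquiv {R : Type} [CommRing R] {F X : ModuleCat.{0} R} {ι : Type} [Fintype ι]
    [DecidableEq ι] (b : Module.Basis ι R F) (d : ℕ) {V : Type} [AddCommGroup V] [Module R V]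
    (ε : Abelian.Ext X (ModuleCat.of R R) d ≃ₗ[R] V) : Abelian.Ext X F d ≃ₗ[R] (ι → V) :=
  LinearEquiv.ofBijective
    (LinearMap.pi fun i => ε.toLinearMap ∘ₗ
      (Abelian.Ext.mk₀ (coordHom b i)).postcompOfLinear R X (add_zero d)) (by
    constructor
    · rw [injective_iff_map_eq_zero]
      intro a ha
      rw [← ext_basis_expand b a]
      refine Finset.sum_eq_zero fun i _ => ?_
      have h1 : ε (a.comp (Abelian.Ext.mk₀ (coordHom b i)) (add_zero d)) = 0 := congrFun ha i
      rw [ε.map_eq_zero_iff.1 h1, Abelian.Ext.zero_comp]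
    · intro v
      refine ⟨∑ i, (ε.symm (v i)).comp (Abelian.Ext.mk₀ (vecHom (b i))) (add_zero d), ?_⟩
      funext j
      change ε ((∑ i, (ε.symm (v i)).comp (Abelian.Ext.mk₀ (vecHom (b i))) (add_zero d)).comp
        (Abelian.Ext.mk₀ (coordHom b j)) (add_zero d)) = v j
      rw [sum_comp', Finset.sum_eq_single j]
      · have : vecHom (b j) ≫ coordHom b j = 𝟙 _ := by
          ext
          simp
        rw [Abelian.Ext.comp_assoc_of_third_deg_zero, Abelian.Ext.mk₀_comp_mk₀, this]
        simp
      · intro i _ hij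
        have : vecHom (b i) ≫ coordHom b j = 0 := by
          ext
          simp [hij]
        rw [Abelian.Ext.comp_assoc_of_third_deg_zero, Abelian.Ext.mk₀_comp_mk₀, this]
        simp
      · simp)

lemma range_lengths {R : Type} [CommRing R] [IsLocalRing R] {F F' X : ModuleCat.{0} R}
    [Projective F] [Module.Finite R F] [Projective F'] [Module.Finite R F'] (d : ℕ)
    (ε : Abelian.Ext X (ModuleCat.of R R) d ≃ₗ[R] IsLocalRing.ResidueField R) (f : F ⟶ F') :
    Module.length R (LinearMap.range
      ((Abelian.Ext.mk₀ f).postcompOfLinear R X (add_zero d))) =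
    Module.length R (LinearMap.range
      (Linear.leftComp R (ModuleCat.of R (IsLocalRing.ResidueField R)) f)) := by
  classical
  have := free_of_proj F
  have := free_of_proj F'
  let b := Module.Free.chooseBasis R F
  let b' := Module.Free.chooseBasis R F'
  let A := LinearMap.toMatrix b b' f.hom
  let B := A.map (algebraMap R (IsLocalRing.ResidueField R))
  rw [length_range_congr _ (B.mulVecLin.restrictScalars R) (extEquiv b d ε) (extEquiv b' d ε),
    length_range_congr (Linear.leftComp R (ModuleCat.of R (IsLocalRing.ResidueField R)) f)
      (B.transpose.mulVecLin.restrictScalars R) (homEquiv b' _) (homEquiv b _),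
    length_range_matrix, length_range_matrix, Matrix.rank_transpose]
  · intro φ
    funext i
    change φ.hom (f.hom (b i)) = ∑ i', (algebraMap R (IsLocalRing.ResidueField R) (A i' i)) * φ.hom (b' i')
    conv_lhs => rw [← b'.sum_repr (f.hom (b i)), map_sum]
    refine Finset.sum_congr rfl fun i' _ => ?_
    rw [map_smul, ← Algebra.smul_def]
    exact congrArg (· • φ.hom (b' i')) (LinearMap.toMatrix_apply b b' f.hom i' i).symm
  · intro a
    funext i'
    change ε ((a.comp (Abelian.Ext.mk₀ f) (add_zero d)).comp
        (Abelian.Ext.mk₀ (coordHom b' i')) (add_zero d)) =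
      ∑ i, (algebraMap R (IsLocalRing.ResidueField R) (A i' i)) *
        ε (a.comp (Abelian.Ext.mk₀ (coordHom b i)) (add_zero d))
    have : f ≫ coordHom b' i' = ∑ i, A i' i • coordHom b i := by
      ext x
      rw [ModuleCat.hom_sum, LinearMap.sum_apply]
      change b'.repr (f.hom x) i' = ∑ i, A i' i * b.repr x i
      rw [← LinearMap.toMatrix_mulVec_repr b b' f.hom x]
      rfl
    rw [Abelian.Ext.comp_assoc_of_third_deg_zero, Abelian.Ext.mk₀_comp_mk₀, this, mk₀_sum',
      comp_sum', map_sum]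
    refine Finset.sum_congr rfl fun i _ => ?_
    rw [Abelian.Ext.mk₀_smul, Abelian.Ext.comp_smul, map_smul, ← Algebra.smul_def]

lemma obj_lengths {R : Type} [CommRing R] [IsLocalRing R] {F X : ModuleCat.{0} R}
    [Projective F] [Module.Finite R F] (d : ℕ)
    (ε : Abelian.Ext X (ModuleCat.of R R) d ≃ₗ[R] IsLocalRing.ResidueField R) :
    Module.length R (Abelian.Ext X F d) =
      Module.length R (F ⟶ ModuleCat.of R (IsLocalRing.ResidueField R)) ∧
    Module.length R (Abelian.Ext X F d) ≠ ⊤ := by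
  classical
  have := free_of_proj F
  let b := Module.Free.chooseBasis R F
  rw [(extEquiv b d ε).length_eq, (homEquiv b _).length_eq]
  exact ⟨rfl, length_pi_residue⟩

end Stmt6

namespace Stmt6

lemma side_one {R : Type} [CommRing R] (K : ChainComplex (ModuleCat.{0} R) ℤ)
    (Y : ModuleCat.{0} R) (j : ℤ) :
    Module.length R ((K.linearYonedaObj R Y).homology (j + 1)) +
      Module.length R (LinearMap.range (Linear.leftComp R Y (K.d (j + 1) j))) +
      Module.length R (LinearMap.range (Linear.leftComp R Y (K.d (j + 1 + 1) (j + 1)))) =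
      Module.length R (K.X (j + 1) ⟶ Y) ∧
    ∀ x : R, (∀ y : Y, x • y = 0) → ∀ v : (K.linearYonedaObj R Y).homology (j + 1), x • v = 0 := by
  let a : (K.X j ⟶ Y) →ₗ[R] (K.X (j + 1) ⟶ Y) := Linear.leftComp R Y (K.d (j + 1) j)
  let b : (K.X (j + 1) ⟶ Y) →ₗ[R] (K.X (j + 1 + 1) ⟶ Y) :=
    Linear.leftComp R Y (K.d (j + 1 + 1) (j + 1))
  let p := ((LinearMap.range a).comap (LinearMap.ker b).subtype).mkQ
  have hker : ∀ x, p x = 0 ↔ ∃ y, a y = (LinearMap.ker b).subtype x := by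
    intro x
    rw [Submodule.mkQ_apply, Submodule.Quotient.mk_eq_zero]
    rfl
  obtain ⟨e⟩ := homology_equiv (K.linearYonedaObj R Y) j (j + 1) (j + 1 + 1) rfl rfl
    (LinearMap.ker b).subtype (Submodule.range_subtype _) p (Submodule.mkQ_surjective _) hker
  constructor
  · rw [e.length_eq]
    refine length_formula a b (LinearMap.ker b).subtype (Submodule.subtype_injective _)
      (Submodule.range_subtype _) ?_ p (Submodule.mkQ_surjective _) hker
    intro x
    change K.d (j + 1 + 1) (j + 1) ≫ K.d (j + 1) j ≫ x = 0
    simp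
  · intro x hx v
    apply e.injective
    rw [map_smul, map_zero]
    obtain ⟨w, hw⟩ := Submodule.mkQ_surjective _ (e v)
    rw [← hw, ← map_smul]
    have : x • w = 0 := by
      apply Subtype.ext
      change x • (w : K.X (j + 1) ⟶ Y) = 0
      ext t
      exact hx _
    rw [this, map_zero]

lemma ext_oc_low {R : Type} [CommRing R] (K : ChainComplex (ModuleCat.{0} R) ℤ)
    (hK : ∀ n, K.ExactAt n) (X : ModuleCat.{0} R) (d : ℕ)
    (h : ∀ p, p < d → ∀ n, ∀ a : Abelian.Ext X (K.X n) p, a = 0) :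
    ∀ p, p < d → ∀ n, ∀ a : Abelian.Ext X (Oc K n) p, a = 0 := by
  intro p
  induction p with
  | zero =>
    intro hp n a
    obtain ⟨n, rfl⟩ : ∃ m, n = m + 1 := ⟨n - 1, by ring⟩
    obtain ⟨w, hS⟩ := oc_ses K n (hK _)
    obtain ⟨f, rfl⟩ := (Abelian.Ext.linearEquiv₀ (R := R) (X := X) (Y := Oc K (n + 1))).symm.surjective a
    have h1 := h 0 hp n (Abelian.Ext.mk₀ (f ≫ OcToX K n))
    have h2 : f ≫ OcToX K n = 0 := by
      apply (Abelian.Ext.linearEquiv₀ (R := R) (X := X) (Y := K.X n)).symm.injective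
      rw [map_zero]
      exact h1
    have : Mono (OcToX K n) := hS.mono_f
    have h3 : f = 0 := by
      rw [← cancel_mono (OcToX K n), h2, zero_comp]
    rw [h3, map_zero]
  | succ p ih =>
    intro hp n a
    obtain ⟨n, rfl⟩ : ∃ m, n = m + 1 := ⟨n - 1, by ring⟩
    obtain ⟨w, hS⟩ := oc_ses K n (hK _)
    obtain ⟨c, hc⟩ := Abelian.Ext.covariant_sequence_exact₁ X hS a (h _ hp _ _) rfl
    have h0 : c = 0 := ih (by omega) n c
    rw [← hc, h0, Abelian.Ext.zero_comp]

lemma ext_oc_inj {R : Type} [CommRing R] (K : ChainComplex (ModuleCat.{0} R) ℤ)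
    (hK : ∀ n, K.ExactAt n) (X : ModuleCat.{0} R) (d : ℕ)
    (h : ∀ p, p < d → ∀ n, ∀ a : Abelian.Ext X (K.X n) p, a = 0) (n : ℤ) :
    Function.Injective ((Abelian.Ext.mk₀ (OcToX K n)).postcompOfLinear R X (add_zero d)) := by
  rw [injective_iff_map_eq_zero]
  intro a ha
  obtain ⟨w, hS⟩ := oc_ses K n (hK _)
  cases d with
  | zero =>
    obtain ⟨f, rfl⟩ := (Abelian.Ext.linearEquiv₀ (R := R) (X := X) (Y := Oc K (n + 1))).symm.surjective a
    have h2 : f ≫ OcToX K n = 0 := by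
      apply (Abelian.Ext.linearEquiv₀ (R := R) (X := X) (Y := K.X n)).symm.injective
      rw [map_zero]
      refine Eq.trans ?_ ha
      exact (Abelian.Ext.mk₀_comp_mk₀ _ _).symm
    have : Mono (OcToX K n) := hS.mono_f
    have h3 : f = 0 := by
      rw [← cancel_mono (OcToX K n), h2, zero_comp]
    rw [h3, map_zero]
  | succ d =>
    obtain ⟨c, hc⟩ := Abelian.Ext.covariant_sequence_exact₁ X hS a ha rfl
    have h0 : c = 0 := ext_oc_low K hK X (d + 1) h d (by omega) n c
    rw [← hc, h0, Abelian.Ext.zero_comp]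

lemma side_two {R : Type} [CommRing R] (K : ChainComplex (ModuleCat.{0} R) ℤ)
    (hK : ∀ n, K.ExactAt n) (X : ModuleCat.{0} R) (d : ℕ)
    (h : ∀ p, p ≠ d → ∀ n, ∀ a : Abelian.Ext X (K.X n) p, a = 0) (j : ℤ) :
    Module.length R (Abelian.Ext X (Oc K (j + 1 + 1 + 1)) (d + 1)) +
      Module.length R (LinearMap.range ((Abelian.Ext.mk₀ (K.d (j + 1 + 1) (j + 1))).postcompOfLinear
        R X (add_zero d))) +
      Module.length R (LinearMap.range ((Abelian.Ext.mk₀ (K.d (j + 1) j)).postcompOfLinear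
        R X (add_zero d))) =
      Module.length R (Abelian.Ext X (K.X (j + 1)) d) := by
  have hinj := ext_oc_inj K hK X d (fun p hp => h p (by omega))
  obtain ⟨w1, hS1⟩ := oc_ses K (j + 1) (hK _)
  obtain ⟨w2, hS2⟩ := oc_ses K (j + 1 + 1) (hK _)
  have hfac : ∀ n, K.d (n + 1) n = XToOc K (n + 1) ≫ OcToX K n := fun n => rfl
  have hcomp : ∀ n (a : Abelian.Ext X (K.X (n + 1)) d),
      a.comp (Abelian.Ext.mk₀ (K.d (n + 1) n)) (add_zero d) =
      (a.comp (Abelian.Ext.mk₀ (XToOc K (n + 1))) (add_zero d)).comp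
        (Abelian.Ext.mk₀ (OcToX K n)) (add_zero d) := by
    intro n a
    rw [Abelian.Ext.comp_assoc_of_third_deg_zero, Abelian.Ext.mk₀_comp_mk₀, ← hfac]
  refine length_formula _ _ ((Abelian.Ext.mk₀ (OcToX K (j + 1))).postcompOfLinear R X (add_zero d))
    (hinj _) ?_ ?_ (hS2.extClass.postcompOfLinear R X (rfl : d + 1 = d + 1)) ?_ ?_
  · ext a
    constructor
    · rintro ⟨y, rfl⟩
      change (y.comp (Abelian.Ext.mk₀ (OcToX K (j + 1))) (add_zero d)).comp
        (Abelian.Ext.mk₀ (K.d (j + 1) j)) (add_zero d) = 0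
      have : OcToX K (j + 1) ≫ K.d (j + 1) j = 0 := by
        rw [hfac, ← Category.assoc, w1, zero_comp]
      rw [Abelian.Ext.comp_assoc_of_third_deg_zero, Abelian.Ext.mk₀_comp_mk₀, this]
      simp
    · intro ha
      have ha' : a.comp (Abelian.Ext.mk₀ (K.d (j + 1) j)) (add_zero d) = 0 := ha
      rw [hcomp] at ha'
      have h0 : a.comp (Abelian.Ext.mk₀ (XToOc K (j + 1))) (add_zero d) = 0 := by
        apply hinj j
        rw [map_zero]
        exact ha'
      exact Abelian.Ext.covariant_sequence_exact₂ X hS1 a h0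
  · intro y
    change (y.comp (Abelian.Ext.mk₀ (K.d (j + 1 + 1) (j + 1))) (add_zero d)).comp
        (Abelian.Ext.mk₀ (K.d (j + 1) j)) (add_zero d) = 0
    rw [Abelian.Ext.comp_assoc_of_third_deg_zero, Abelian.Ext.mk₀_comp_mk₀, K.d_comp_d]
    simp
  · intro a
    exact Abelian.Ext.covariant_sequence_exact₁ X hS2 a (h _ (by omega) _ _) rfl
  · intro a
    constructor
    · intro ha
      obtain ⟨c, hc⟩ := Abelian.Ext.covariant_sequence_exact₃ X hS2 a rfl ha
      refine ⟨c, ?_⟩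
      change c.comp (Abelian.Ext.mk₀ (K.d (j + 1 + 1) (j + 1))) (add_zero d) =
        a.comp (Abelian.Ext.mk₀ (OcToX K (j + 1))) (add_zero d)
      rw [hcomp, ← hc]
    · rintro ⟨y, hy⟩
      have hy' : y.comp (Abelian.Ext.mk₀ (K.d (j + 1 + 1) (j + 1))) (add_zero d) =
        a.comp (Abelian.Ext.mk₀ (OcToX K (j + 1))) (add_zero d) := hy
      rw [hcomp] at hy'
      have h0 : y.comp (Abelian.Ext.mk₀ (XToOc K (j + 1 + 1))) (add_zero d) = a := hinj (j + 1) hy'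
      rw [← h0]
      change (y.comp (Abelian.Ext.mk₀ (XToOc K (j + 1 + 1))) (add_zero d)).comp hS2.extClass rfl = 0
      rw [Abelian.Ext.comp_assoc_of_second_deg_zero]
      have : (Abelian.Ext.mk₀ (XToOc K (j + 1 + 1))).comp hS2.extClass (zero_add 1) = 0 :=
        hS2.comp_extClass
      rw [this, Abelian.Ext.comp_zero]

lemma enat_cancel {v v' a b x x' : ℕ∞} (h1 : v + a + b = x) (h2 : v' + b + a = x') (h3 : x' = x)
    (h4 : x' ≠ ⊤) : v ≠ ⊤ ∧ v = v' := by
  subst h3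
  have h5 : v + (a + b) = v' + (a + b) := by
    rw [← add_assoc, h1, add_comm a b, ← add_assoc, h2]
  constructor
  · rintro rfl
    simp at h1
    exact h4 h1.symm
  · refine WithTop.add_right_cancel ?_ h5
    intro h
    rw [add_assoc, h] at h1
    exact h4 (by rw [← h1]; exact add_top _)

theorem tate_ext_iso {R : Type} [CommRing R] [IsLocalRing R] (hR : IsGorensteinLocalRing R)
    (d : ℕ) (hd : ringKrullDim R = d) (M : ModuleCat.{0} R) (CM : CompleteResolution R M) (i : ℤ) :
    Nonempty (TateExt R CM (ModuleCat.of R (IsLocalRing.ResidueField R)) i ≃ₗ[R]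
      Abelian.Ext (ModuleCat.of R (IsLocalRing.ResidueField R)) (Oc CM.T (i + 2)) (d + 1)) := by
  obtain ⟨hG, ⟨ε⟩⟩ := gorenstein_ext hR d hd
  obtain ⟨j, rfl⟩ : ∃ j, i = j + 1 := ⟨i - 1, by ring⟩
  rw [show j + 1 + 2 = j + 1 + 1 + 1 by ring]
  have hk : ∀ x ∈ IsLocalRing.maximalIdeal R, ∀ y : IsLocalRing.ResidueField R, x • y = 0 := by
    intro x hx y
    rw [Algebra.smul_def]
    have : algebraMap R (IsLocalRing.ResidueField R) x = 0 := Ideal.Quotient.eq_zero_iff_mem.2 hx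
    rw [this, zero_mul]
  have := CM.projT
  have := CM.fgT
  obtain ⟨h1, h1k⟩ := side_one CM.T (ModuleCat.of R (IsLocalRing.ResidueField R)) j
  have h2 := side_two CM.T CM.exactT (ModuleCat.of R (IsLocalRing.ResidueField R)) d
    (fun p hp n a => ext_free_zero _ _ p (hG p hp) a) j
  rw [range_lengths d ε, range_lengths d ε] at h2
  obtain ⟨h3, h4⟩ := obj_lengths (F := CM.T.X (j + 1))
    (X := ModuleCat.of R (IsLocalRing.ResidueField R)) d ε
  obtain ⟨h5, h6⟩ := enat_cancel h1 h2 h3 h4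
  refine killed_iso (fun x hx => h1k x (hk x hx)) (fun x hx v => ?_) h5 h6
  exact ext_smul_eq_zero_left (N := ModuleCat.of R (IsLocalRing.ResidueField R)) (hk x hx) v

end Stmt6

/-- Let `R` be a Gorenstein local ring of dimension `d` and `M` a finitely generated
`R`-module. Then `β̂_i(M) = μ̂^{d-i-1}(M)` for all `i ∈ ℤ`: the stable Betti number
`rank_k Êxt^i_R(M,k)` equals the stable Bass number `rank_k Êxt^{d-i-1}_R(k,M)`,
i.e. the corresponding Tate cohomology modules are isomorphic. -/
theorem stmt_6 (R : Type) [CommRing R] [IsLocalRing R] (hR : IsGorensteinLocalRing R)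
    (d : ℕ) (hd : ringKrullDim R = d)
    (M : Type) [AddCommGroup M] [Module R M] [Module.Finite R M]
    (CM : CompleteResolution R (ModuleCat.of R M))
    (Ck : CompleteResolution R (ModuleCat.of R (IsLocalRing.ResidueField R))) (i : ℤ) :
    Nonempty ((TateExt R CM (ModuleCat.of R (IsLocalRing.ResidueField R)) i) ≃ₗ[R]
      (TateExt R Ck (ModuleCat.of R M) ((d : ℤ) - i - 1))) := by
  obtain ⟨e1⟩ := Stmt6.tate_ext_iso hR d hd (ModuleCat.of R M) CM i
  obtain ⟨e2⟩ := Stmt6.tate_to_ext hR d hd (ModuleCat.of R M) CM Ck i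
  exact ⟨e1.trans e2.symm⟩

end
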